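/- arXiv:2312.08340 — 5 statements merged into one kernel-verified Lean document; each statement's English description precedes it below -/
import Mathlib

section
/- There is an absolute constant c > 0 such that for every positive integer k, every finite simple graph G with chromatic number χ(G) = k, and every real number d with √k/2 ≤ d ≤ √k, the probability that the chromatic number of the random subgraph G_{1/2} is at most d satisfies P(χ(G_{1/2}) ≤ d) ≤ exp(−c·(√k − d)²/√k). -/
open scoped Classical

/-- Probability, for the random subgraph of `G` in which each edge of `G` is retained
independently with probability `p`, of the event `A`. -/
noncomputable def subgraphProb {V : Type} [Fintype V] (G : SimpleGraph V)
    (p : ℝ) (A : SimpleGraph V → Prop) : ℝ :=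
  ∑ s ∈ G.edgeSet.toFinset.powerset,
    (if A (SimpleGraph.fromEdgeSet ↑s) then
      p ^ s.card * (1 - p) ^ (G.edgeSet.toFinset.card - s.card) else 0)

/-- The average of `f` over all subsets of `A`. -/
noncomputable def powersetAvg {α : Type} (A : Finset α) (f : Finset α → ℝ) : ℝ :=
  (∑ s ∈ A.powerset, f s) / 2 ^ A.card

theorem sum_powerset_union {α : Type} [DecidableEq α] (A B : Finset α) (h : Disjoint A B)
    (f : Finset α → ℝ) :
    ∑ s ∈ (A ∪ B).powerset, f s = ∑ s ∈ A.powerset, ∑ t ∈ B.powerset, f (s ∪ t) := by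
  induction B using Finset.induction_on generalizing f with
  | empty => simp
  | insert a B ha ih =>
    rw [Finset.disjoint_insert_right] at h
    have ha' : a ∉ A ∪ B := by simp [h.1, ha]
    rw [Finset.union_insert, Finset.sum_powerset_insert ha', ih h.2,
      ih h.2 (fun s => f (insert a s)), ← Finset.sum_add_distrib]
    refine Finset.sum_congr rfl fun s _ => ?_
    rw [Finset.sum_powerset_insert ha]
    simp [Finset.union_insert]

theorem powersetAvg_union {α : Type} [DecidableEq α] (A B : Finset α) (h : Disjoint A B)
    (f : Finset α → ℝ) :
    powersetAvg (A ∪ B) f = powersetAvg A fun s => powersetAvg B fun t => f (s ∪ t) := by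
  unfold powersetAvg
  rw [sum_powerset_union A B h, Finset.card_union_of_disjoint h, ← Finset.sum_div, div_div,
    pow_add, mul_comm]

theorem powersetAvg_mono {α : Type} (A : Finset α) {f g : Finset α → ℝ}
    (h : ∀ s ⊆ A, f s ≤ g s) : powersetAvg A f ≤ powersetAvg A g := by
  unfold powersetAvg
  gcongr with s hs
  exact h s (Finset.mem_powerset.1 hs)

theorem powersetAvg_const {α : Type} (A : Finset α) (c : ℝ) :
    powersetAvg A (fun _ => c) = c := by
  simp [powersetAvg]

theorem powersetAvg_add {α : Type} (A : Finset α) (f g : Finset α → ℝ) :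
    powersetAvg A (fun s => f s + g s) = powersetAvg A f + powersetAvg A g := by
  simp [powersetAvg, Finset.sum_add_distrib, add_div]

theorem powersetAvg_mul_left {α : Type} (A : Finset α) (c : ℝ) (f : Finset α → ℝ) :
    powersetAvg A (fun s => c * f s) = c * powersetAvg A f := by
  simp [powersetAvg, ← Finset.mul_sum, mul_div_assoc]

theorem powersetAvg_compl {α : Type} [DecidableEq α] (A : Finset α) (f : Finset α → ℝ) :
    powersetAvg A (fun s => f (A \ s)) = powersetAvg A f := by
  unfold powersetAvg
  congr 1
  refine Finset.sum_nbij' (fun s => A \ s) (fun s => A \ s) ?_ ?_ ?_ ?_ ?_ <;>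
    simp +contextual

theorem abs_sub_powersetAvg_le {α : Type} (A : Finset α) (f : Finset α → ℝ) (x : ℝ)
    (h : ∀ t ⊆ A, |x - f t| ≤ 1) : |x - powersetAvg A f| ≤ 1 := by
  have h1 : powersetAvg A f ≤ powersetAvg A (fun _ => x + 1) :=
    powersetAvg_mono A fun t ht => by linarith [(abs_le.1 (h t ht)).1]
  have h2 : powersetAvg A (fun _ => x - 1) ≤ powersetAvg A f :=
    powersetAvg_mono A fun t ht => by linarith [(abs_le.1 (h t ht)).2]
  rw [powersetAvg_const] at h1 h2
  exact abs_le.2 ⟨by linarith, by linarith⟩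

theorem exp_mul_le_cosh_add (l y : ℝ) (hy : |y| ≤ 1) :
    Real.exp (l * y) ≤ Real.cosh l + y * Real.sinh l := by
  obtain ⟨h1, h2⟩ := abs_le.1 hy
  have := convexOn_exp.2 (Set.mem_univ l) (Set.mem_univ (-l))
    (show 0 ≤ (1 + y) / 2 by linarith) (show 0 ≤ (1 - y) / 2 by linarith) (by ring)
  simp only [smul_eq_mul] at this
  rw [show (1 + y) / 2 * l + (1 - y) / 2 * -l = l * y by ring] at this
  rw [Real.cosh_eq, Real.sinh_eq]
  linarith

theorem powersetAvg_exp_le {α : Type} (A : Finset α) (f : Finset α → ℝ) (l : ℝ)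
    (h : ∀ s ⊆ A, ∀ t ⊆ A, |f s - f t| ≤ 1) :
    powersetAvg A (fun s => Real.exp (l * f s)) ≤
      Real.exp (l * powersetAvg A f + l ^ 2 / 2) := by
  set m := powersetAvg A f with hm
  have key : powersetAvg A (fun s => Real.exp (l * f s)) ≤
      powersetAvg A (fun s => Real.exp (l * m) * (Real.cosh l - m * Real.sinh l) +
        Real.exp (l * m) * Real.sinh l * f s) := by
    refine powersetAvg_mono A fun s hs => ?_
    have h1 := exp_mul_le_cosh_add l (f s - m) (abs_sub_powersetAvg_le A f _ (h s hs))
    calc Real.exp (l * f s) = Real.exp (l * m) * Real.exp (l * (f s - m)) := by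
          rw [← Real.exp_add]; ring_nf
      _ ≤ Real.exp (l * m) * (Real.cosh l + (f s - m) * Real.sinh l) := by gcongr
      _ = _ := by ring
  rw [powersetAvg_add, powersetAvg_const, powersetAvg_mul_left, ← hm] at key
  calc _ ≤ _ := key
    _ = Real.exp (l * m) * Real.cosh l := by ring
    _ ≤ Real.exp (l * m) * Real.exp (l ^ 2 / 2) := by
        gcongr; exact Real.cosh_le_exp_half_sq l
    _ = _ := (Real.exp_add _ _).symm

/-- Exponential moment bound for functions of a uniformly random subset that change by at most
one when the subset is altered inside a single block `U (j + 1) \ U j`. -/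
theorem powersetAvg_exp_le_of_blocks {α : Type} [DecidableEq α]
    (U : ℕ → Finset α) (hU : Monotone U)
    (h0 : U 0 = ∅) (l : ℝ) (n : ℕ) (f : Finset α → ℝ)
    (hf : ∀ j < n, ∀ s t : Finset α, (∀ e ∉ U (j + 1) \ U j, e ∈ s ↔ e ∈ t) →
      |f s - f t| ≤ 1) :
    powersetAvg (U n) (fun s => Real.exp (l * f s)) ≤
      Real.exp (l * powersetAvg (U n) f + n * (l ^ 2 / 2)) := by
  induction n generalizing f with
  | zero => simp [h0, powersetAvg]
  | succ n ih =>
    set B := U (n + 1) \ U n with hB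
    have hUB : U (n + 1) = U n ∪ B :=
      (Finset.union_sdiff_of_subset (hU (Nat.le_succ n))).symm
    have hd : Disjoint (U n) B := Finset.disjoint_sdiff
    rw [hUB, powersetAvg_union _ _ hd, powersetAvg_union _ _ hd]
    set g : Finset α → ℝ := fun s => powersetAvg B fun t => f (s ∪ t) with hg
    have hgl := ih g fun j hj s t hst => by
      have h1 : ∀ r, |f (s ∪ r) - f (t ∪ r)| ≤ 1 := fun r =>
        hf j (hj.trans n.lt_succ_self) _ _ fun e he => by
          simp only [Finset.mem_union, hst e he]
      have h2 : g s ≤ powersetAvg B (fun r => 1 + f (t ∪ r)) :=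
        powersetAvg_mono B fun r _ => by linarith [(abs_le.1 (h1 r)).2]
      have h3 : g t ≤ powersetAvg B (fun r => 1 + f (s ∪ r)) :=
        powersetAvg_mono B fun r _ => by linarith [(abs_le.1 (h1 r)).1]
      rw [powersetAvg_add, powersetAvg_const] at h2 h3
      exact abs_le.2 ⟨by linarith, by linarith⟩
    calc _ ≤ powersetAvg (U n) (fun s => Real.exp (l ^ 2 / 2) * Real.exp (l * g s)) := by
          refine powersetAvg_mono _ fun s _ => ?_
          rw [← Real.exp_add, add_comm]
          refine powersetAvg_exp_le B (fun t => f (s ∪ t)) l fun t ht t' ht' => ?_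
          refine hf n n.lt_succ_self _ _ fun e he => ?_
          simp only [Finset.mem_union]
          have h1 : e ∉ t := fun h => he (ht h)
          have h2 : e ∉ t' := fun h => he (ht' h)
          simp [h1, h2]
      _ ≤ Real.exp (l ^ 2 / 2) * Real.exp (l * powersetAvg (U n) g + n * (l ^ 2 / 2)) := by
          rw [powersetAvg_mul_left]; gcongr
      _ = _ := by
          rw [← Real.exp_add]; push_cast; ring_nf

/-- The adjacency relation `r` can be properly coloured on the vertex set `W` with colours
less than `m`. -/
def ColorableOn {V : Type} (r : V → V → Prop) (W : Set V) (m : ℕ) : Prop :=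
  ∃ c : V → ℕ, (∀ u ∈ W, c u < m) ∧ ∀ u ∈ W, ∀ v ∈ W, r u v → c u ≠ c v

theorem colorableOn_univ_iff {V : Type} (G : SimpleGraph V) (m : ℕ) :
    ColorableOn G.Adj Set.univ m ↔ G.Colorable m := by
  rw [SimpleGraph.colorable_iff_exists_bdd_nat_coloring]
  constructor
  · rintro ⟨c, h1, h2⟩
    exact ⟨SimpleGraph.Coloring.mk c fun h => h2 _ trivial _ trivial h,
      fun v => h1 v trivial⟩
  · rintro ⟨c, hc⟩
    exact ⟨c, fun u _ => hc u, fun u _ v _ h => c.valid h⟩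

/-- Some vertex set that is `m`-colourable in `G` can be deleted so that the graph with edge
set `s` becomes `D`-colourable. -/
def ColorableAfterDeletion {V : Type} (G : SimpleGraph V) (D : ℕ) (s : Finset (Sym2 V))
    (m : ℕ) : Prop :=
  ∃ W : Set V, ColorableOn G.Adj W m ∧ ColorableOn (fun u v => s(u, v) ∈ s) Wᶜ D

/-- The least `G`-chromatic number of a vertex set whose deletion makes the graph with edge
set `s` `D`-colourable. -/
noncomputable def deletionCost {V : Type} (G : SimpleGraph V) (D : ℕ)
    (s : Finset (Sym2 V)) : ℕ :=
  sInf {m | ColorableAfterDeletion G D s m}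

section DeletionCost

variable {V : Type} {G : SimpleGraph V} {k : ℕ}

theorem colorableAfterDeletion_deletionCost (hG : G.Colorable k) (D : ℕ)
    (s : Finset (Sym2 V)) : ColorableAfterDeletion G D s (deletionCost G D s) := by
  refine Nat.sInf_mem (s := {m | ColorableAfterDeletion G D s m}) ⟨k, Set.univ, ?_, ?_⟩
  · rwa [colorableOn_univ_iff]
  · exact ⟨fun _ => 0, by simp, by simp⟩

theorem deletionCost_le_add_one (hG : G.Colorable k) (C : V → ℕ)
    (hC : ∀ u v, G.Adj u v → C u ≠ C v) (D j : ℕ) (s t : Finset (Sym2 V))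
    (hst : ∀ u v, C u ≠ j → C v ≠ j → s(u, v) ∈ t → s(u, v) ∈ s) :
    deletionCost G D t ≤ deletionCost G D s + 1 := by
  obtain ⟨W, ⟨c, hc1, hc2⟩, a, ha1, ha2⟩ := colorableAfterDeletion_deletionCost hG D s
  refine Nat.sInf_le ⟨W ∪ {v | C v = j},
    ⟨fun v => if C v = j then deletionCost G D s else c v, ?_, ?_⟩, a, ?_, ?_⟩
  · intro u hu
    by_cases h : C u = j
    · simp [h]
    · have := hc1 u (hu.resolve_right h)
      simp only [h, if_false]
      omega
  · intro u hu v hv huv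
    by_cases h : C u = j <;> by_cases h' : C v = j
    · exact absurd (h.trans h'.symm) (hC u v huv)
    · have := hc1 v (hv.resolve_right h')
      simp only [h, h', if_true, if_false]
      omega
    · have := hc1 u (hu.resolve_right h)
      simp only [h, h', if_true, if_false]
      omega
    · simp only [h, h', if_false]
      exact hc2 u (hu.resolve_right h) v (hv.resolve_right h') huv
  · exact fun u hu => ha1 u fun h => hu (Or.inl h)
  · intro u hu v hv huv
    exact ha2 u (fun h => hu (Or.inl h)) v (fun h => hv (Or.inl h))
      (hst u v (fun h => hu (Or.inr h)) (fun h => hv (Or.inr h)) huv)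

theorem colorable_deletionCost_add (hG : G.Colorable k) (D : ℕ) (s t : Finset (Sym2 V))
    (hst : ∀ u v, G.Adj u v → s(u, v) ∈ s ∨ s(u, v) ∈ t) :
    G.Colorable (deletionCost G D s + deletionCost G D t + D * D) := by
  obtain ⟨W, ⟨c, hc1, hc2⟩, a, ha1, ha2⟩ := colorableAfterDeletion_deletionCost hG D s
  obtain ⟨X, ⟨e, he1, he2⟩, b, hb1, hb2⟩ := colorableAfterDeletion_deletionCost hG D t
  generalize deletionCost G D s = m at *
  generalize deletionCost G D t = n at *
  rw [← colorableOn_univ_iff]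
  refine ⟨fun v => if v ∈ W then c v else if v ∈ X then m + e v else m + n + (a v + D * b v),
    ?_, ?_⟩
  · intro u _
    by_cases hW : u ∈ W
    · have := hc1 u hW
      simp only [hW, if_true]
      omega
    by_cases hX : u ∈ X
    · have := he1 u hX
      simp only [hW, hX, if_true, if_false]
      omega
    · have h1 := ha1 u hW
      have h2 := hb1 u hX
      simp only [hW, hX, if_false]
      nlinarith
  · intro u _ v _ huv
    by_cases hW : u ∈ W <;> by_cases hW' : v ∈ W
    · simp only [hW, hW', if_true]
      exact hc2 u hW v hW' huv
    · have := hc1 u hW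
      simp only [hW, hW', if_true, if_false]
      split_ifs <;> omega
    · have := hc1 v hW'
      simp only [hW, hW', if_true, if_false]
      split_ifs <;> omega
    simp only [hW, hW', if_false]
    by_cases hX : u ∈ X <;> by_cases hX' : v ∈ X
    · have := he2 u hX v hX' huv
      simp only [hX, hX', if_true]
      omega
    · have := he1 u hX
      simp only [hX, hX', if_true, if_false]
      omega
    · have := he1 v hX'
      simp only [hX, hX', if_true, if_false]
      omega
    simp only [hX, hX', if_false]
    intro heq
    have heq' : a u + D * b u = a v + D * b v := by omega
    have h1 := ha1 u hW
    have h2 := ha1 v hW'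
    have hmod : a u = a v := by
      have := congrArg (· % D) heq'
      simpa [Nat.add_mul_mod_self_left, Nat.mod_eq_of_lt h1, Nat.mod_eq_of_lt h2] using this
    have hdiv : b u = b v := by
      have : D * b u = D * b v := by omega
      exact Nat.eq_of_mul_eq_mul_left (by omega) this
    rcases hst u v huv with h | h
    · exact ha2 u hW v hW' h hmod
    · exact hb2 u hX v hX' h hdiv

theorem deletionCost_eq_zero (D : ℕ) (s : Finset (Sym2 V))
    (hs : (SimpleGraph.fromEdgeSet (s : Set (Sym2 V))).Colorable D)
    (hdiag : ∀ v, s(v, v) ∉ s) : deletionCost G D s = 0 := by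
  refine Nat.le_zero.1 (Nat.sInf_le ⟨∅, ⟨fun _ => 0, by simp, by simp⟩, ?_⟩)
  obtain ⟨c, h1, h2⟩ := (colorableOn_univ_iff _ _).2 hs
  refine ⟨c, fun u _ => h1 u trivial, fun u _ v _ huv => h2 u trivial v trivial ?_⟩
  rw [SimpleGraph.fromEdgeSet_adj]
  refine ⟨huv, ?_⟩
  rintro rfl
  exact hdiag _ huv

end DeletionCost

theorem subgraphProb_half {V : Type} [Fintype V] (G : SimpleGraph V)
    (A : SimpleGraph V → Prop) :
    subgraphProb G (1 / 2) A = powersetAvg G.edgeSet.toFinset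
      (fun s => if A (SimpleGraph.fromEdgeSet ↑s) then 1 else 0) := by
  unfold subgraphProb powersetAvg
  rw [Finset.sum_div]
  refine Finset.sum_congr rfl fun s hs => ?_
  split_ifs
  · rw [show (1 - 1 / 2 : ℝ) = 1 / 2 by norm_num, ← pow_add,
      Nat.add_sub_cancel' (Finset.card_le_card (Finset.mem_powerset.1 hs)), one_div_pow]
  · simp

theorem powersetAvg_exp_deletionCost_le {V : Type} [Fintype V] (G : SimpleGraph V) (k D : ℕ)
    (hG : G.Colorable k) (l : ℝ) :
    powersetAvg G.edgeSet.toFinset (fun s => Real.exp (l * deletionCost G D s)) ≤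
      Real.exp (l * powersetAvg G.edgeSet.toFinset (fun s => (deletionCost G D s : ℝ)) +
        k * (l ^ 2 / 2)) := by
  obtain ⟨C, hCk, hC⟩ := (colorableOn_univ_iff G k).2 hG
  set U : ℕ → Finset (Sym2 V) := fun n => G.edgeSet.toFinset.filter fun e => ∀ v ∈ e, C v < n
    with hU
  have hUk : U k = G.edgeSet.toFinset :=
    Finset.filter_true_of_mem fun e _ v _ => hCk v trivial
  have hmono : Monotone U := fun m n hmn e he => by
    simp only [hU, Finset.mem_filter] at he ⊢
    exact ⟨he.1, fun v hv => (he.2 v hv).trans_le hmn⟩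
  have h0 : U 0 = ∅ := by
    refine Finset.filter_false_of_mem fun e _ h => ?_
    induction e with
    | _ u v => exact absurd (h u (Sym2.mem_mk_left u v)) (Nat.not_lt_zero _)
  rw [← hUk]
  refine powersetAvg_exp_le_of_blocks U hmono h0 l k _ fun j _ s t hst => ?_
  have hblock : ∀ u v, C u ≠ j → C v ≠ j → s(u, v) ∉ U (j + 1) \ U j := by
    intro u v hu hv he
    simp only [hU, Finset.mem_sdiff, Finset.mem_filter, Sym2.mem_iff, forall_eq_or_imp,
      forall_eq, not_and] at he
    have := he.2 he.1.1
    omega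
  have hadj := fun u v => hC u trivial v trivial
  have h1 := deletionCost_le_add_one hG C hadj D j s t fun u v hu hv h =>
    (hst _ (hblock u v hu hv)).2 h
  have h2 := deletionCost_le_add_one hG C hadj D j t s fun u v hu hv h =>
    (hst _ (hblock u v hu hv)).1 h
  have h1' : (deletionCost G D t : ℝ) ≤ deletionCost G D s + 1 := by exact_mod_cast h1
  have h2' : (deletionCost G D s : ℝ) ≤ deletionCost G D t + 1 := by exact_mod_cast h2
  exact abs_le.2 ⟨by linarith, by linarith⟩

theorem le_two_mul_powersetAvg_deletionCost {V : Type} [Fintype V] (G : SimpleGraph V)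
    (k D : ℕ) (hG : G.chromaticNumber = (k : ℕ∞)) :
    (k : ℝ) - D * D ≤
      2 * powersetAvg G.edgeSet.toFinset (fun s => (deletionCost G D s : ℝ)) := by
  have hGk : G.Colorable k := SimpleGraph.chromaticNumber_le_iff_colorable.1 hG.le
  have key : powersetAvg G.edgeSet.toFinset (fun _ => (k : ℝ) - D * D) ≤
      powersetAvg G.edgeSet.toFinset (fun s => (deletionCost G D s : ℝ) +
        deletionCost G D (G.edgeSet.toFinset \ s)) := by
    refine powersetAvg_mono _ fun s _ => ?_
    have h := colorable_deletionCost_add hGk D s (G.edgeSet.toFinset \ s) fun u v huv => by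
      by_cases h : s(u, v) ∈ s <;> simp [h, huv]
    have h' := SimpleGraph.chromaticNumber_le_iff_colorable.2 h
    rw [hG] at h'
    have h'' : k ≤ deletionCost G D s + deletionCost G D (G.edgeSet.toFinset \ s) + D * D := by
      exact_mod_cast h'
    have h''' : (k : ℝ) ≤
        deletionCost G D s + deletionCost G D (G.edgeSet.toFinset \ s) + D * D := by
      exact_mod_cast h''
    linarith
  rw [powersetAvg_const, powersetAvg_add,
    powersetAvg_compl _ (fun s => (deletionCost G D s : ℝ))] at key
  linarith

theorem subgraphProb_chromaticNumber_le {V : Type} [Fintype V] (G : SimpleGraph V)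
    (k : ℕ) (hG : G.chromaticNumber = (k : ℕ∞)) (d : ℝ) (hd : 0 ≤ d) (l : ℝ) :
    subgraphProb G (1 / 2) (fun G' => ((G'.chromaticNumber.toNat : ℝ) ≤ d)) ≤
      Real.exp (-l * powersetAvg G.edgeSet.toFinset
        (fun s => (deletionCost G ⌊d⌋₊ s : ℝ)) + k * (l ^ 2 / 2)) := by
  have hGk : G.Colorable k := SimpleGraph.chromaticNumber_le_iff_colorable.1 hG.le
  rw [subgraphProb_half]
  refine le_trans (powersetAvg_mono _ fun s hs => ?_)
    ((powersetAvg_exp_deletionCost_le G k ⌊d⌋₊ hGk (-l)).trans_eq (by rw [neg_sq]))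
  split_ifs with h
  · have hcol : (SimpleGraph.fromEdgeSet (s : Set (Sym2 V))).Colorable ⌊d⌋₊ :=
      (SimpleGraph.colorable_chromaticNumber (SimpleGraph.colorable_of_fintype _)).mono
        ((Nat.le_floor_iff hd).2 h)
    rw [deletionCost_eq_zero _ s hcol fun v hv => by simpa using hs hv]
    simp
  · positivity

/-- Shinkar's bound: for a graph `G` with chromatic number `k` and `√k/2 ≤ d ≤ √k`,
`P(χ(G_{1/2}) ≤ d) ≤ exp (-c (√k - d)² / √k)` for an absolute constant `c > 0`. -/
theorem chromatic_lower_tail_range_one :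
    ∃ c : ℝ, 0 < c ∧
      ∀ (k : ℕ), 0 < k →
        ∀ (V : Type) [Fintype V] (G : SimpleGraph V), G.chromaticNumber = (k : ℕ∞) →
          ∀ d : ℝ, Real.sqrt k / 2 ≤ d → d ≤ Real.sqrt k →
            subgraphProb G (1/2) (fun G' => ((G'.chromaticNumber.toNat : ℝ) ≤ d)) ≤
              Real.exp (-c * (Real.sqrt k - d) ^ 2 / Real.sqrt k) := by
  refine ⟨1 / 8, by norm_num, fun k hk V _ G hG d hd1 hd2 => ?_⟩
  have hk1 : (1 : ℝ) ≤ k := by exact_mod_cast hk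
  have hr1 : 1 ≤ Real.sqrt k := Real.one_le_sqrt.2 hk1
  have hrk : Real.sqrt k ^ 2 = k := Real.sq_sqrt (by linarith)
  have hd : 0 ≤ d := by linarith
  have hm := le_two_mul_powersetAvg_deletionCost G k ⌊d⌋₊ hG
  have hP := subgraphProb_chromaticNumber_le G k hG d hd
  set μ := powersetAvg G.edgeSet.toFinset (fun s => (deletionCost G ⌊d⌋₊ s : ℝ))
  set r := Real.sqrt k
  have hfl : (⌊d⌋₊ : ℝ) ≤ d := Nat.floor_le hd
  have hfl2 : (⌊d⌋₊ : ℝ) * ⌊d⌋₊ ≤ d * d := by gcongr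
  have hμ : r * (r - d) ≤ 2 * μ := by nlinarith
  have hsq : (r * (r - d)) ^ 2 ≤ (2 * μ) ^ 2 := by
    have : 0 ≤ r * (r - d) := mul_nonneg (by linarith) (by linarith)
    gcongr
  refine (hP (μ / k)).trans (Real.exp_le_exp.2 ?_)
  have h1 : -(μ / k) * μ + k * ((μ / k) ^ 2 / 2) = -(μ ^ 2 / (2 * k)) := by
    field_simp
    ring
  have h2 : (r - d) ^ 2 / 8 ≤ μ ^ 2 / (2 * k) := by
    rw [le_div_iff₀ (by linarith), ← hrk]
    nlinarith
  have h3 : (r - d) ^ 2 / r ≤ (r - d) ^ 2 := div_le_self (sq_nonneg _) hr1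
  rw [h1, mul_div_assoc]
  linarith
end

section
/- There is an absolute constant c > 0 such that for every positive integer k, every finite simple graph G with chromatic number χ(G) = k, and every real number d with k^{1/3} ≤ d ≤ √k/2, the probability that the chromatic number of the random subgraph G_{1/2} is at most d satisfies P(χ(G_{1/2}) ≤ d) ≤ exp(−c·k/d). -/
open scoped Classical

open Finset

lemma le_three_sub_of_mul_le_one {u g h : ℝ} (hu : u ≤ 2) (hug : u * g ≤ 1) (huh : u * h ≤ 1)
    (hg : g ≤ 1) (hh : h ≤ 1) : u ≤ 3 - g - h := by
  have key : ∀ a : ℝ, u * a ≤ 1 → a ≤ 1 → u ≤ 3 - 2 * a := by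
    intro a h1 h2
    by_cases ha : a ≤ 1 / 2
    · linarith
    · push Not at ha
      have : u * a ≤ (3 - 2 * a) * a := by nlinarith
      exact le_of_mul_le_mul_right this (by linarith)
  rcases le_total g h with hgh | hgh
  · linarith [key h huh hh]
  · linarith [key g hug hg]

lemma three_mul_sub_mul_mul_le_cube {m x y : ℝ} (hx : 0 ≤ x) (hy : 0 ≤ y) (hxm : x ≤ m)
    (hym : y ≤ m) : (3 * m - x - y) * (x * y) ≤ m ^ 3 := by
  have h1 : x * y ≤ ((x + y) / 2) ^ 2 := by nlinarith [sq_nonneg (x - y)]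
  have h2 : (3 * m - x - y) * (x * y) ≤ (3 * m - x - y) * ((x + y) / 2) ^ 2 :=
    mul_le_mul_of_nonneg_left h1 (by linarith)
  have h3 : (3 * m - x - y) * ((x + y) / 2) ^ 2 ≤ m ^ 3 := by
    have h4 : m ^ 3 - (3 * m - x - y) * ((x + y) / 2) ^ 2
      = (m - (x + y) / 2) ^ 2 * (m + (x + y)) := by ring
    have : 0 ≤ (m - (x + y) / 2) ^ 2 * (m + (x + y)) :=
      mul_nonneg (sq_nonneg _) (by linarith)
    linarith
  linarith

lemma card_eq_sum_card_cons {n : ℕ} {α : Fin (n + 1) → Type*} [∀ i, Fintype (α i)]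
    (A : Finset (∀ i, α i)) :
    A.card = ∑ w : α 0, (univ.filter fun x : ∀ i : Fin n, α i.succ => Fin.cons w x ∈ A).card := by
  have h : A.card = ∑ z : ∀ i, α i, if z ∈ A then 1 else 0 := by simp
  rw [h, ← (Fin.consEquiv α).sum_comp, Fintype.sum_prod_type]
  simp only [Finset.card_filter]
  rfl

lemma sum_mul_le_of_fibre_bounds {ι : Type*} [Fintype ι] {S a b : ι → ℝ} {p q N : ℝ}
    (hN : 0 < N) (hp : 0 ≤ p) (hq : 0 ≤ q) (ha : ∀ w, 0 ≤ a w) (hb : ∀ w, 0 ≤ b w)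
    (hap : ∀ w, a w ≤ p) (hbq : ∀ w, b w ≤ q)
    (h0 : ∀ w, S w * p * q ≤ 2 * N ^ 3) (h1 : ∀ w, S w * a w * q ≤ N ^ 3)
    (h2 : ∀ w, S w * p * b w ≤ N ^ 3) :
    (∑ w, S w) * (∑ w, a w) * (∑ w, b w) ≤ ((Fintype.card ι : ℝ) * N) ^ 3 := by
  have hR : 0 ≤ ((Fintype.card ι : ℝ) * N) ^ 3 := by positivity
  rcases hp.eq_or_lt with rfl | hp
  · have : ∑ w, a w = 0 := Finset.sum_eq_zero fun w _ => le_antisymm (hap w) (ha w)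
    simpa [this] using hR
  rcases hq.eq_or_lt with rfl | hq
  · have : ∑ w, b w = 0 := Finset.sum_eq_zero fun w _ => le_antisymm (hbq w) (hb w)
    simpa [this] using hR
  have hN3 : 0 < N ^ 3 := by positivity
  have hu : ∀ w, S w * p * q / N ^ 3 ≤ 3 - a w / p - b w / q := by
    intro w
    apply le_three_sub_of_mul_le_one
    · rw [div_le_iff₀ hN3]; exact h0 w
    · have : S w * p * q / N ^ 3 * (a w / p) = S w * a w * q / N ^ 3 := by field_simp
      rw [this, div_le_one hN3]; exact h1 w
    · have : S w * p * q / N ^ 3 * (b w / q) = S w * p * b w / N ^ 3 := by field_simp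
      rw [this, div_le_one hN3]; exact h2 w
    · rw [div_le_one hp]; exact hap w
    · rw [div_le_one hq]; exact hbq w
  set X := ∑ w, a w / p with hX
  set Y := ∑ w, b w / q with hY
  have hX0 : 0 ≤ X := Finset.sum_nonneg fun w _ => div_nonneg (ha w) hp.le
  have hY0 : 0 ≤ Y := Finset.sum_nonneg fun w _ => div_nonneg (hb w) hq.le
  have hXM : X ≤ Fintype.card ι := by
    calc X ≤ ∑ w : ι, (1 : ℝ) := Finset.sum_le_sum fun w _ => (div_le_one hp).2 (hap w)
      _ = _ := by simp
  have hYM : Y ≤ Fintype.card ι := by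
    calc Y ≤ ∑ w : ι, (1 : ℝ) := Finset.sum_le_sum fun w _ => (div_le_one hq).2 (hbq w)
      _ = _ := by simp
  have hU : ∑ w, S w * p * q / N ^ 3 ≤ 3 * Fintype.card ι - X - Y := by
    calc _ ≤ ∑ w, (3 - a w / p - b w / q) := Finset.sum_le_sum fun w _ => hu w
      _ = _ := by simp [Finset.sum_sub_distrib, hX, hY, mul_comm]
  have e1 : ∑ w, S w * p * q / N ^ 3 = (∑ w, S w) * p * q / N ^ 3 := by
    rw [← Finset.sum_div, ← Finset.sum_mul, ← Finset.sum_mul]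
  have e2 : ∑ w, a w = p * X := by rw [hX, ← Finset.sum_div]; field_simp
  have e3 : ∑ w, b w = q * Y := by rw [hY, ← Finset.sum_div]; field_simp
  rw [e1] at hU
  calc (∑ w, S w) * (∑ w, a w) * (∑ w, b w)
      = N ^ 3 * ((∑ w, S w) * p * q / N ^ 3 * (X * Y)) := by rw [e2, e3]; field_simp
    _ ≤ N ^ 3 * ((3 * Fintype.card ι - X - Y) * (X * Y)) := by gcongr
    _ ≤ N ^ 3 * (Fintype.card ι : ℝ) ^ 3 := by
        gcongr; exact three_mul_sub_mul_mul_le_cube hX0 hY0 hXM hYM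
    _ = _ := by ring

/-- Talagrand's control by two points, for the uniform measure on a finite product. -/
theorem sum_two_pow_mul_card_mul_card_le {n : ℕ} {α : Fin n → Type*} [∀ i, Fintype (α i)]
    [∀ i, Nonempty (α i)] (A B : Finset (∀ i, α i)) (f : (∀ i, α i) → ℕ)
    (hf : ∀ x, ∀ y ∈ A, ∀ z ∈ B, f x ≤ (univ.filter fun i => x i ≠ y i ∧ x i ≠ z i).card) :
    (∑ x, (2 : ℝ) ^ f x) * A.card * B.card ≤ (Fintype.card (∀ i, α i) : ℝ) ^ 3 := by
  induction n with
  | zero =>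
    rcases A.eq_empty_or_nonempty with rfl | ⟨y, hy⟩
    · simp
    rcases B.eq_empty_or_nonempty with rfl | ⟨z, hz⟩
    · simp
    have h0 : ∀ x, f x = 0 := fun x => by simpa using hf x y hy z hz
    have hA : (A.card : ℝ) ≤ 1 := by exact_mod_cast Finset.card_le_one_of_subsingleton A
    have hB : (B.card : ℝ) ≤ 1 := by exact_mod_cast Finset.card_le_one_of_subsingleton B
    simp only [h0]
    simp
    nlinarith [(Nat.cast_nonneg A.card : (0:ℝ) ≤ _), (Nat.cast_nonneg B.card : (0:ℝ) ≤ _)]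
  | succ n ih =>
    let Ω := ∀ i : Fin n, α i.succ
    let sec : Finset (∀ i, α i) → α 0 → Finset Ω := fun C w => univ.filter fun x => Fin.cons w x ∈ C
    let proj : Finset (∀ i, α i) → Finset Ω := fun C => univ.filter fun x => ∃ w, Fin.cons w x ∈ C
    have hsub : ∀ C w, ((sec C w).card : ℝ) ≤ (proj C).card := by
      intro C w
      exact_mod_cast Finset.card_le_card fun x hx => by
        simp only [sec, proj, mem_filter, mem_univ, true_and] at hx ⊢
        exact ⟨w, hx⟩
    have hcard : (Fintype.card (∀ i, α i) : ℝ) = (Fintype.card (α 0) : ℝ) * Fintype.card Ω := by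
      rw [← Nat.cast_mul, ← Fintype.card_prod, Fintype.card_congr (Fin.consEquiv α)]
    have hsum : ∑ x, (2 : ℝ) ^ f x = ∑ w : α 0, ∑ x : Ω, (2 : ℝ) ^ f (Fin.cons w x) := by
      rw [← (Fin.consEquiv α).sum_comp, Fintype.sum_prod_type]
      rfl
    have hdist : ∀ (w v v' : α 0) (x y z : Ω),
        (univ.filter fun i => (Fin.cons w x : ∀ i, α i) i ≠ (Fin.cons v y : ∀ i, α i) i ∧
          (Fin.cons w x : ∀ i, α i) i ≠ (Fin.cons v' z : ∀ i, α i) i).card =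
        (if w ≠ v ∧ w ≠ v' then 1 else 0) + (univ.filter fun i => x i ≠ y i ∧ x i ≠ z i).card := by
      intro w v v' x y z
      rw [Fin.card_filter_univ_succ]
      simp only [Fin.cons_zero, Fin.cons_succ]
      split_ifs <;> simp [add_comm]
    rw [hcard, hsum, card_eq_sum_card_cons A, card_eq_sum_card_cons B]
    push_cast
    apply sum_mul_le_of_fibre_bounds (p := (proj A).card) (q := (proj B).card)
    · exact_mod_cast Fintype.card_pos
    · positivity
    · positivity
    · intro w; positivity
    · intro w; positivity
    · exact hsub A
    · exact hsub B
    · intro w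
      have := ih (proj A) (proj B) (fun x => f (Fin.cons w x) - 1) (by
        intro x y hy z hz
        simp only [proj, mem_filter, mem_univ, true_and] at hy hz
        obtain ⟨v, hv⟩ := hy
        obtain ⟨v', hv'⟩ := hz
        have := hf (Fin.cons w x) _ hv _ hv'
        rw [hdist] at this
        split_ifs at this <;> omega)
      have h2 : ∑ x : Ω, (2 : ℝ) ^ f (Fin.cons w x) ≤
          2 * ∑ x : Ω, (2 : ℝ) ^ (f (Fin.cons w x) - 1) := by
        rw [Finset.mul_sum]
        refine Finset.sum_le_sum fun x _ => ?_
        rw [← pow_succ']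
        exact pow_le_pow_right₀ (by norm_num) (by omega)
      calc _ ≤ (2 * ∑ x : Ω, (2 : ℝ) ^ (f (Fin.cons w x) - 1)) * (proj A).card * (proj B).card := by
            gcongr
        _ = 2 * ((∑ x : Ω, (2 : ℝ) ^ (f (Fin.cons w x) - 1)) * (proj A).card * (proj B).card) := by
            ring
        _ ≤ _ := by gcongr
    · intro w
      refine ih (sec A w) (proj B) (fun x => f (Fin.cons w x)) ?_
      intro x y hy z hz
      simp only [sec, proj, mem_filter, mem_univ, true_and] at hy hz
      obtain ⟨v', hv'⟩ := hz
      have := hf (Fin.cons w x) _ hy _ hv'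
      rw [hdist] at this
      simpa using this
    · intro w
      refine ih (proj A) (sec B w) (fun x => f (Fin.cons w x)) ?_
      intro x y hy z hz
      simp only [sec, proj, mem_filter, mem_univ, true_and] at hy hz
      obtain ⟨v', hv'⟩ := hy
      have := hf (Fin.cons w x) _ hv' _ hz
      rw [hdist] at this
      simpa using this

namespace SimpleGraph

variable {V : Type*}

lemma Colorable.mul_of_le_sup {G H K : SimpleGraph V} {a b : ℕ} (hH : H.Colorable a)
    (hK : K.Colorable b) (h : G ≤ H ⊔ K) : G.Colorable (a * b) := by
  obtain ⟨c⟩ := hH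
  obtain ⟨c'⟩ := hK
  have C : G.Coloring (Fin a × Fin b) := Coloring.mk (fun v => (c v, c' v)) (by
    intro u v huv heq
    simp only [Prod.mk.injEq] at heq
    rcases h huv with h | h
    · exact c.valid h heq.1
    · exact c'.valid h heq.2)
  simpa using C.colorable

/-- If every edge of `H` lies in the block of one of its ends and each block of `H` outside `I`
agrees with the corresponding block of `H₁` or of `H₂`, then `H` can be coloured with the colours
of `H₁`, those of `H₂` and one more colour for each class in `I`. -/
lemma colorable_of_blocks {ι : Type*} {H H₁ H₂ : SimpleGraph V} {a b : ℕ}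
    (h₁ : H₁.Colorable a) (h₂ : H₂.Colorable b) (C : H.Coloring ι) (P Q : ι → Prop)
    (I : Finset ι) (hI : ∀ i, P i ∨ Q i ∨ i ∈ I)
    (hP : ∀ u v, H.Adj u v → P (C u) → P (C v) → H₁.Adj u v)
    (hQ : ∀ u v, H.Adj u v → Q (C u) → Q (C v) → H₂.Adj u v) :
    H.Colorable (a + b + I.card) := by
  obtain ⟨c₁⟩ := h₁
  obtain ⟨c₂⟩ := h₂
  have K : H.Coloring ((Fin a ⊕ Fin b) ⊕ I) := Coloring.mk
    (fun v => if P (C v) then .inl (.inl (c₁ v)) else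
      if Q (C v) then .inl (.inr (c₂ v)) else
        if h : C v ∈ I then .inr ⟨C v, h⟩ else .inl (.inl (c₁ v))) (by
    intro u v huv heq
    have hu := hI (C u)
    have hv := hI (C v)
    have n := C.valid huv
    have n₁ := fun p q => c₁.valid (hP u v huv p q)
    have n₂ := fun p q => c₂.valid (hQ u v huv p q)
    split_ifs at heq <;> simp_all)
  simpa using K.colorable

lemma colorable_toNat_chromaticNumber [Fintype V] (H : SimpleGraph V) :
    H.Colorable H.chromaticNumber.toNat :=
  colorable_of_chromaticNumber_ne_top (chromaticNumber_ne_top_iff_exists.2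
    ⟨_, H.colorable_of_fintype⟩)

lemma Colorable.toNat_chromaticNumber_le {H : SimpleGraph V} {n : ℕ} (h : H.Colorable n) :
    H.chromaticNumber.toNat ≤ n :=
  ENat.toNat_le_of_le_natCast h.chromaticNumber_le

end SimpleGraph

lemma subgraphProb_half_s1 {V : Type} [Fintype V] (G : SimpleGraph V) (A : SimpleGraph V → Prop) :
    subgraphProb G (1 / 2) A =
      (univ.filter fun x : Set G.edgeSet => A (.fromEdgeSet (Subtype.val '' x))).card /
        2 ^ Fintype.card G.edgeSet := by
  have h1 : subgraphProb G (1 / 2) A = ∑ s ∈ G.edgeSet.toFinset.powerset,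
      if A (SimpleGraph.fromEdgeSet ↑s) then (1 / 2 : ℝ) ^ G.edgeSet.toFinset.card else 0 := by
    refine Finset.sum_congr rfl fun s hs => ?_
    split_ifs
    · norm_num only [show (1 - 1 / 2 : ℝ) = 1 / 2 by norm_num]
      rw [← pow_add, Nat.add_sub_cancel' (Finset.card_le_card (Finset.mem_powerset.1 hs))]
    · rfl
  have h2 : (G.edgeSet.toFinset.powerset.filter fun s : Finset (Sym2 V) => A (.fromEdgeSet ↑s)).card =
      (univ.filter fun x : Set G.edgeSet => A (.fromEdgeSet (Subtype.val '' x))).card := by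
    symm
    refine Finset.card_bij (fun x _ => (Subtype.val '' x : Set (Sym2 V)).toFinset) ?_ ?_ ?_
    · intro x hx
      simp only [mem_filter, mem_univ, true_and] at hx
      simp only [mem_filter, mem_powerset, Set.coe_toFinset]
      refine ⟨?_, hx⟩
      rw [Set.toFinset_subset_toFinset]
      exact Subtype.coe_image_subset _ _
    · intro x _ y _ hxy
      rw [Set.toFinset_inj] at hxy
      exact Set.image_injective.2 Subtype.val_injective hxy
    · intro s hs
      simp only [mem_filter, mem_powerset, Set.subset_toFinset] at hs
      have : (Subtype.val '' (Subtype.val ⁻¹' (s : Set (Sym2 V)) : Set G.edgeSet)) =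
          (s : Set (Sym2 V)) := by
        rw [Subtype.image_preimage_coe, Set.inter_eq_right]; exact hs.1
      refine ⟨Subtype.val ⁻¹' (s : Set (Sym2 V)), ?_, ?_⟩
      · simp only [mem_filter, mem_univ, true_and]
        rw [this]; exact hs.2
      · apply Finset.coe_injective
        rw [Set.coe_toFinset, this]
  rw [h1, ← Finset.sum_filter, Finset.sum_const, h2, Set.toFinset_card]
  simp [div_eq_mul_inv]

/-- Grouping the elements of a type into the fibres of a map. -/
def setFibresEquiv {E ι : Type*} (b : E → ι) : (∀ i, Set {e // b e = i}) ≃ Set E where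
  toFun x := {e | ⟨e, rfl⟩ ∈ x (b e)}
  invFun s i := {e | e.1 ∈ s}
  left_inv x := by
    funext i
    ext ⟨e, rfl⟩
    rfl
  right_inv s := rfl

/-- Control by two points for the uniform measure on subsets of `E`, partitioned into blocks. -/
theorem sum_two_pow_mul_card_sq_le_of_blocks {E : Type*} [Fintype E] {n : ℕ} (b : E → Fin n)
    (A : Finset (Set E)) (f : Set E → ℕ)
    (hf : ∀ x, ∀ y ∈ A, ∀ z ∈ A, f x ≤
      (univ.filter fun i => ¬ (∀ e, b e = i → (e ∈ x ↔ e ∈ y)) ∧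
        ¬ (∀ e, b e = i → (e ∈ x ↔ e ∈ z))).card) :
    (∑ x, (2 : ℝ) ^ f x) * A.card ^ 2 ≤ ((2 : ℝ) ^ Fintype.card E) ^ 3 := by
  let φ := setFibresEquiv b
  have hne : ∀ x y : ∀ i, Set {e // b e = i}, ∀ i,
      x i ≠ y i ↔ ¬ ∀ e, b e = i → (e ∈ φ x ↔ e ∈ φ y) := by
    intro x y i
    rw [ne_eq, not_iff_not, Set.ext_iff]
    constructor
    · rintro h e rfl
      exact h ⟨e, rfl⟩
    · rintro h ⟨e, rfl⟩
      exact h e rfl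
  have key := sum_two_pow_mul_card_mul_card_le (A.map φ.symm.toEmbedding)
    (A.map φ.symm.toEmbedding) (fun x => f (φ x)) (by
      intro x y hy z hz
      rw [Finset.mem_map_equiv, Equiv.symm_symm] at hy hz
      simpa only [hne] using hf _ _ hy _ hz)
  rw [φ.sum_comp (fun x => (2 : ℝ) ^ f x), Fintype.card_congr φ, Fintype.card_set,
    Finset.card_map, mul_assoc, ← sq] at key
  exact_mod_cast key

/-- For a graph `G` with chromatic number `k` and `k^{1/3} ≤ d ≤ √k/2`,
`P(χ(G_{1/2}) ≤ d) ≤ exp (-c k / d)` for an absolute constant `c > 0`. -/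
theorem chromatic_lower_tail_range_two :
    ∃ c : ℝ, 0 < c ∧
      ∀ (k : ℕ), 0 < k →
        ∀ (V : Type) [Fintype V] (G : SimpleGraph V), G.chromaticNumber = (k : ℕ∞) →
          ∀ d : ℝ, (k : ℝ) ^ ((1 : ℝ)/3) ≤ d → d ≤ Real.sqrt k / 2 →
            subgraphProb G (1/2) (fun G' => ((G'.chromaticNumber.toNat : ℝ) ≤ d)) ≤
              Real.exp (-c * k / d) := by
  refine ⟨Real.log 2 / 6, by have := Real.log_pos one_lt_two; positivity, ?_⟩
  intro k hk V _ G hG d hd hdk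
  have hk' : (0 : ℝ) < k := by exact_mod_cast hk
  have hd0 : 0 < d := lt_of_lt_of_le (by positivity) hd
  have hkd : 4 * d ^ 2 ≤ k := by
    have := Real.sq_sqrt hk'.le
    nlinarith
  rw [subgraphProb_half_s1]
  obtain ⟨C⟩ : G.Colorable k := SimpleGraph.chromaticNumber_le_iff_colorable.1 hG.le
  let H : Set G.edgeSet → SimpleGraph V := fun x => .fromEdgeSet (Subtype.val '' x)
  let X : Set G.edgeSet → ℕ := fun x => (H x).chromaticNumber.toNat
  have hadj : ∀ x u v, (H x).Adj u v ↔ ∃ h : G.Adj u v, (⟨s(u, v), h⟩ : G.edgeSet) ∈ x := by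
    intro x u v
    simp only [H, SimpleGraph.fromEdgeSet_adj, Set.mem_image, Subtype.exists, exists_and_right,
      exists_eq_right]
    exact ⟨fun h => h.1, fun h => ⟨h, h.1.ne⟩⟩
  let b : G.edgeSet → Fin k := fun e => (e.1.map C).sup
  have hb : ∀ u v (h : G.Adj u v), b ⟨s(u, v), h⟩ = C u ∨ b ⟨s(u, v), h⟩ = C v := by
    intro u v h
    exact max_choice (C u) (C v)
  let A : Finset (Set G.edgeSet) := univ.filter fun x => (X x : ℝ) ≤ d
  have hXA : ∀ x ∈ A, (H x).Colorable ⌊d⌋₊ := by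
    intro x hx
    simp only [A, mem_filter, mem_univ, true_and] at hx
    exact (SimpleGraph.colorable_toNat_chromaticNumber (H x)).mono (Nat.le_floor hx)
  have hcompl : ∀ x, k ≤ X x * X xᶜ := by
    intro x
    have : G.Colorable (X x * X xᶜ) :=
      (SimpleGraph.colorable_toNat_chromaticNumber (H x)).mul_of_le_sup
        (SimpleGraph.colorable_toNat_chromaticNumber (H xᶜ)) (by
          intro u v h
          rw [SimpleGraph.sup_adj, hadj, hadj]
          by_cases hx : (⟨s(u, v), h⟩ : G.edgeSet) ∈ x
          · exact .inl ⟨h, hx⟩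
          · exact .inr ⟨h, hx⟩)
    have h2 := this.chromaticNumber_le
    rw [hG] at h2
    exact_mod_cast h2
  have key := sum_two_pow_mul_card_sq_le_of_blocks b A (fun x => X x - (⌊d⌋₊ + ⌊d⌋₊)) (by
    intro x y hy z hz
    rw [tsub_le_iff_left]
    apply SimpleGraph.Colorable.toNat_chromaticNumber_le
    refine SimpleGraph.colorable_of_blocks (hXA y hy) (hXA z hz)
      (C.comp (.ofLE fun u v h => ((hadj x u v).1 h).1))
      (fun i => ∀ e, b e = i → (e ∈ x ↔ e ∈ y)) (fun i => ∀ e, b e = i → (e ∈ x ↔ e ∈ z)) _ ?_ ?_ ?_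
    · intro i
      simp only [mem_filter, mem_univ, true_and]
      tauto
    all_goals
      intro u v huv hu hv
      rw [hadj] at huv ⊢
      obtain ⟨h, hx⟩ := huv
      refine ⟨h, ?_⟩
      rcases hb u v h with h' | h'
      · exact (hu _ h').1 hx
      · exact (hv _ h').1 hx)
  have hlow : (A.card : ℝ) * (2 : ℝ) ^ (k / (2 * d)) ≤
      ∑ x, (2 : ℝ) ^ (X x - (⌊d⌋₊ + ⌊d⌋₊)) := by
    rw [← (compl_bijective (α := Set G.edgeSet)).sum_comp, ← nsmul_eq_mul, ← Finset.sum_const]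
    refine (Finset.sum_le_sum fun x hx => ?_).trans
      (Finset.sum_le_univ_sum_of_nonneg fun x => by positivity)
    rw [← Real.rpow_natCast]
    apply Real.rpow_le_rpow_of_exponent_le one_le_two
    simp only [A, mem_filter, mem_univ, true_and] at hx
    have h1 : (k : ℝ) ≤ X x * X xᶜ := by exact_mod_cast hcompl x
    have h2 : (k : ℝ) / d ≤ X xᶜ := by
      rw [div_le_iff₀ hd0]
      nlinarith [(Nat.cast_nonneg (X xᶜ) : (0 : ℝ) ≤ _)]
    have h3 : (⌊d⌋₊ : ℝ) ≤ d := Nat.floor_le hd0.le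
    have h4 : 2 * d ≤ k / (2 * d) := by rw [le_div_iff₀ (by positivity)]; nlinarith
    have h5 : (k : ℝ) / (2 * d) = k / d / 2 := by field_simp
    have h6 : (X xᶜ : ℝ) ≤ (X xᶜ - (⌊d⌋₊ + ⌊d⌋₊) : ℕ) + (⌊d⌋₊ + ⌊d⌋₊) := by
      exact_mod_cast (by omega : X xᶜ ≤ X xᶜ - (⌊d⌋₊ + ⌊d⌋₊) + (⌊d⌋₊ + ⌊d⌋₊))
    change (k : ℝ) / (2 * d) ≤ (X xᶜ - (⌊d⌋₊ + ⌊d⌋₊) : ℕ)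
    linarith
  set N : ℝ := 2 ^ Fintype.card G.edgeSet with hN
  have hN0 : 0 < N := by positivity
  change (A.card : ℝ) / N ≤ _
  have hexp : (2 : ℝ) ^ ((k : ℝ) / (2 * d)) * Real.exp (-(Real.log 2 / 6) * k / d) ^ 3 = 1 := by
    rw [Real.rpow_def_of_pos two_pos, ← Real.exp_nat_mul, ← Real.exp_add, Real.exp_eq_one_iff]
    field_simp
    norm_num
  refine le_of_pow_le_pow_left₀ (n := 3) (by norm_num) (Real.exp_pos _).le ?_
  have hT : 0 < (2 : ℝ) ^ ((k : ℝ) / (2 * d)) := by positivity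
  refine le_of_mul_le_mul_left ?_ hT
  rw [hexp, div_pow, ← mul_div_assoc, div_le_one (by positivity)]
  calc _ = (A.card : ℝ) * (2 : ℝ) ^ ((k : ℝ) / (2 * d)) * A.card ^ 2 := by ring
    _ ≤ _ := (mul_le_mul_of_nonneg_right hlow (by positivity)).trans key
end

section
/- For every p ∈ (0,1) and every ε > 0 there exists n₀ such that for every n ≥ n₀ and every finite simple graph G on n vertices with chromatic number χ(G) = k, the probability that the chromatic number of the random subgraph G_p is at least p·k/(2·ln n) is at least 1 − ε. -/
open scoped Classical

open Finset in
/-- If every nonempty subset of `S` has a vertex with fewer than `d` neighbours inside the subset,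
then `S` can be properly coloured with `d` colours. -/
theorem SimpleGraph.exists_coloring_of_degenerate {V : Type*} (G : SimpleGraph V)
    (d : ℕ) (S : Finset V)
    (h : ∀ T ⊆ S, T.Nonempty → ∃ v ∈ T, #{x ∈ T | G.Adj v x} < d) :
    ∃ f : V → ℕ, (∀ x ∈ S, f x < d) ∧ ∀ x ∈ S, ∀ y ∈ S, G.Adj x y → f x ≠ f y := by
  induction S using Finset.strongInduction with
  | H S ih =>
    rcases S.eq_empty_or_nonempty with rfl | hS
    · exact ⟨fun _ => 0, by simp, by simp⟩
    obtain ⟨v, hvS, hv⟩ := h S subset_rfl hS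
    obtain ⟨f, hfd, hf⟩ := ih (S.erase v) (erase_ssubset hvS)
      (fun T hT => h T (hT.trans (erase_subset _ _)))
    obtain ⟨c, hc, hc'⟩ : ∃ c ∈ range d, c ∉ image f {x ∈ S | G.Adj v x} :=
      exists_mem_notMem_of_card_lt_card (card_image_le.trans_lt (by simpa using hv))
    have hne : ∀ x ∈ S, G.Adj v x → c ≠ f x := fun x hx hvx hcx =>
      hc' (mem_image.2 ⟨x, by simp [hx, hvx], hcx.symm⟩)
    refine ⟨Function.update f v c, fun x hx => ?_, fun x hx y hy hxy => ?_⟩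
    · by_cases hxv : x = v
      · subst hxv; simpa using hc
      · simpa [hxv] using hfd x (mem_erase.2 ⟨hxv, hx⟩)
    · by_cases hxv : x = v
      · subst hxv
        simpa [hxy.ne'] using hne y hy hxy
      · by_cases hyv : y = v
        · subst hyv
          simpa [hxv] using (hne x hx hxy.symm).symm
        · simpa [hxv, hyv] using hf x (mem_erase.2 ⟨hxv, hx⟩) y (mem_erase.2 ⟨hyv, hy⟩) hxy

open Finset in
/-- If `G'` is `c`-colourable and `G` is not `c * d`-colourable, some nonempty `G'`-independent
set induces a subgraph of `G` of minimum degree at least `d`. -/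
theorem SimpleGraph.exists_indep_of_not_colorable {V : Type*} [Fintype V] (G G' : SimpleGraph V)
    (c d : ℕ) (hG' : G'.Colorable c) (hG : ¬ G.Colorable (c * d)) :
    ∃ T : Finset V, T.Nonempty ∧ (∀ v ∈ T, d ≤ #{x ∈ T | G.Adj v x}) ∧
      ∀ x ∈ T, ∀ y ∈ T, ¬ G'.Adj x y := by
  by_contra! hcon
  obtain ⟨C⟩ := hG'
  have key : ∀ i : Fin c, ∃ f : V → ℕ, (∀ x ∈ ({x | C x = i} : Finset V), f x < d) ∧
      ∀ x ∈ ({x | C x = i} : Finset V), ∀ y ∈ ({x | C x = i} : Finset V),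
        G.Adj x y → f x ≠ f y := by
    refine fun i => G.exists_coloring_of_degenerate d _ fun T hT hne => ?_
    by_contra! hdeg
    obtain ⟨x, hx, y, hy, hxy⟩ := hcon T hne hdeg
    have hx' := hT hx
    have hy' := hT hy
    simp only [mem_filter, mem_univ, true_and] at hx' hy'
    exact C.valid hxy (hx'.trans hy'.symm)
  choose f hfd hf using key
  have hfd' : ∀ x, f (C x) x < d := fun x => hfd (C x) x (by simp)
  let D : G.Coloring (Fin c × Fin d) := SimpleGraph.Coloring.mk
    (fun x => (C x, ⟨f (C x) x, hfd' x⟩)) (by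
      intro x y hxy heq
      simp only [Prod.mk.injEq, Fin.mk.injEq] at heq
      refine hf (C x) x (by simp) y (by simp [heq.1]) hxy ?_
      rw [heq.2, heq.1])
  exact hG (by simpa using D.colorable)

/-- The subgraph of `G` formed by the edges with both ends in `T`. -/
def SimpleGraph.edgesWithin {V : Type*} (G : SimpleGraph V) (T : Finset V) : SimpleGraph V where
  Adj x y := G.Adj x y ∧ x ∈ T ∧ y ∈ T
  symm := ⟨fun _ _ h => ⟨h.1.symm, h.2.2, h.2.1⟩⟩
  loopless := ⟨fun _ h => h.1.ne rfl⟩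

open Finset in
theorem SimpleGraph.card_mul_le_two_mul_card_edgesWithin {V : Type*} [Fintype V]
    (G : SimpleGraph V) (T : Finset V) (d : ℕ) (h : ∀ v ∈ T, d ≤ #{x ∈ T | G.Adj v x}) :
    #T * d ≤ 2 * #(G.edgesWithin T).edgeSet.toFinset := by
  have hsum := (G.edgesWithin T).sum_degrees_eq_twice_card_edges
  calc #T * d = ∑ v ∈ T, d := by simp
    _ ≤ ∑ v ∈ T, (G.edgesWithin T).degree v := by
      refine sum_le_sum fun v hv => (h v hv).trans ?_
      rw [← SimpleGraph.card_neighborFinset_eq_degree]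
      refine card_le_card fun x hx => ?_
      simp only [mem_filter] at hx
      exact (SimpleGraph.mem_neighborFinset _ _ _).2 ⟨hx.2, hv, hx.1⟩
    _ ≤ ∑ v, (G.edgesWithin T).degree v := sum_le_univ_sum_of_nonneg (by simp)
    _ = _ := by rw [hsum]; congr!

open Finset in
/-- A random subset of `E` with edge probability `p` avoids `F ⊆ E` with probability
`(1 - p) ^ #F`. -/
theorem sum_disjoint_weight {α : Type*} [DecidableEq α] (E F : Finset α) (hF : F ⊆ E) (p : ℝ) :
    ∑ s ∈ E.powerset, (if Disjoint s F then p ^ #s * (1 - p) ^ (#E - #s) else 0)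
      = (1 - p) ^ #F := by
  have hfilter : E.powerset.filter (Disjoint · F) = (E \ F).powerset := by
    ext s
    simp [subset_sdiff]
  rw [← sum_filter, hfilter]
  have hcard : #(E \ F) + #F = #E := card_sdiff_add_card_eq_card hF
  calc ∑ s ∈ (E \ F).powerset, p ^ #s * (1 - p) ^ (#E - #s)
      = ∑ s ∈ (E \ F).powerset, (1 - p) ^ #F * (p ^ #s * (1 - p) ^ (#(E \ F) - #s)) := by
        refine sum_congr rfl fun s hs => ?_
        have hs' := card_le_card (mem_powerset.1 hs)
        rw [show #E - #s = #F + (#(E \ F) - #s) by omega, pow_add]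
        ring
    _ = _ := by rw [← mul_sum, sum_pow_mul_eq_add_pow]; simp

open Finset in
/-- Union bound: if failure of `A` forces the random edge set to avoid some `F t`, then the failure
probability is at most `∑ t, (1 - p) ^ #(F t)`. -/
theorem one_sub_sum_le_subgraphProb {V : Type} [Fintype V] {ι : Type*} (G : SimpleGraph V) (p : ℝ)
    (hp0 : 0 ≤ p) (hp1 : p ≤ 1) (A : SimpleGraph V → Prop) (I : Finset ι)
    (F : ι → Finset (Sym2 V)) (hF : ∀ t ∈ I, F t ⊆ G.edgeSet.toFinset)
    (h : ∀ s : Finset (Sym2 V), ¬ A (SimpleGraph.fromEdgeSet ↑s) → ∃ t ∈ I, Disjoint s (F t)) :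
    1 - ∑ t ∈ I, (1 - p) ^ #(F t) ≤ subgraphProb G p A := by
  unfold subgraphProb
  set E := G.edgeSet.toFinset
  have htotal : ∑ s ∈ E.powerset, p ^ #s * (1 - p) ^ (#E - #s) = 1 := by
    rw [sum_pow_mul_eq_add_pow]; simp
  have hw : ∀ s : Finset (Sym2 V), 0 ≤ p ^ #s * (1 - p) ^ (#E - #s) := fun s =>
    mul_nonneg (pow_nonneg hp0 _) (pow_nonneg (sub_nonneg.2 hp1) _)
  rw [sum_congr rfl fun t ht => (sum_disjoint_weight E (F t) (hF t ht) p).symm, sum_comm,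
    sub_le_iff_le_add, ← sum_add_distrib]
  refine htotal.ge.trans ?_
  refine sum_le_sum fun s _ => ?_
  have hnonneg : ∀ t ∈ I, 0 ≤ if Disjoint s (F t) then p ^ #s * (1 - p) ^ (#E - #s) else 0 :=
    fun t _ => by split_ifs <;> simp [hw]
  by_cases hA : A (SimpleGraph.fromEdgeSet ↑s)
  · simpa [hA] using sum_nonneg hnonneg
  · obtain ⟨t, ht, hdis⟩ := h s hA
    simpa [hA, hdis] using single_le_sum hnonneg ht

open Finset in
theorem sum_pow_card_le {V : Type*} [Fintype V] (d : ℕ) (q c : ℝ) (hq : 0 ≤ q)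
    (hc : Fintype.card V * q ≤ c) :
    ∑ T : Finset V with d ≤ #T, q ^ #T
      ≤ ∑ m ∈ range (Fintype.card V + 1) with d ≤ m, c ^ m / m.factorial := by
  rw [sum_filter, sum_filter, ← powerset_univ,
    sum_powerset_apply_card (fun m => if d ≤ m then q ^ m else 0), card_univ]
  refine sum_le_sum fun m _ => ?_
  split_ifs
  · rw [nsmul_eq_mul]
    calc ((Fintype.card V).choose m : ℝ) * q ^ m
        ≤ (Fintype.card V : ℝ) ^ m / m.factorial * q ^ m := by
          gcongr
          exact Nat.choose_le_pow_div m _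
      _ = (Fintype.card V * q) ^ m / m.factorial := by rw [mul_pow]; ring
      _ ≤ c ^ m / m.factorial := by gcongr
  · simp

open Finset in
theorem exists_sum_pow_div_factorial_lt (c ε : ℝ) (hε : 0 < ε) :
    ∃ N : ℕ, ∀ d, N ≤ d → ∀ n, ∑ m ∈ range n with d ≤ m, c ^ m / m.factorial < ε := by
  obtain ⟨s, hs⟩ := summable_iff_vanishing_norm.1 (Real.summable_pow_div_factorial c) ε hε
  refine ⟨s.sup id + 1, fun d hd n => (le_abs_self _).trans_lt (hs _ ?_)⟩
  rw [Finset.disjoint_left]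
  intro m hm hms
  have hle : m ≤ s.sup id := le_sup (f := id) hms
  have := (mem_filter.1 hm).2
  omega

/-- For every `p ∈ (0,1)` and `ε > 0`, for all large enough `n`, every `n`-vertex graph `G`
with chromatic number `k` satisfies `χ(G_p) ≥ p k / (2 ln n)` with probability at least `1 - ε`. -/
theorem chromatic_whp_lower_bound (p : ℝ) (hp0 : 0 < p) (hp1 : p < 1) (ε : ℝ) (hε : 0 < ε) :
    ∃ n₀ : ℕ, ∀ n : ℕ, n₀ ≤ n →
      ∀ (V : Type) [Fintype V], Fintype.card V = n →
        ∀ (G : SimpleGraph V) (k : ℕ), G.chromaticNumber = (k : ℕ∞) →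
          1 - ε ≤ subgraphProb G p
            (fun G' => p * (k : ℝ) / (2 * Real.log n) ≤ (G'.chromaticNumber.toNat : ℝ)) := by
  obtain ⟨N, hN⟩ := exists_sum_pow_div_factorial_lt (Real.exp (p / 2)) ε hε
  have htend : Filter.Tendsto (fun n : ℕ => ⌊2 * Real.log n / p⌋₊) Filter.atTop Filter.atTop :=
    tendsto_nat_floor_atTop.comp (((Real.tendsto_log_atTop.comp
      tendsto_natCast_atTop_atTop).const_mul_atTop two_pos).atTop_div_const hp0)
  obtain ⟨n₀, hn₀⟩ := Filter.eventually_atTop.1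
    ((htend.eventually_ge_atTop N).and (Filter.eventually_ge_atTop 2))
  refine ⟨n₀, fun n hn V _ hV G k hk => ?_⟩
  obtain ⟨hNd, hn2⟩ := hn₀ n hn
  set d := ⌊2 * Real.log n / p⌋₊ with hd
  have hn0 : (0 : ℝ) < n := by positivity
  have hlog : 0 < Real.log n := Real.log_pos (by exact_mod_cast hn2)
  have hdle : (d : ℝ) * p ≤ 2 * Real.log n :=
    (le_div_iff₀ hp0).1 (Nat.floor_le (by positivity))
  have hdlt : 2 * Real.log n < (d + 1) * p := (div_lt_iff₀ hp0).1 (Nat.lt_floor_add_one _)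
  have hnq : (Fintype.card V : ℝ) * Real.exp (-(p * d / 2)) ≤ Real.exp (p / 2) := by
    calc (Fintype.card V : ℝ) * Real.exp (-(p * d / 2))
        = Real.exp (Real.log n + -(p * d / 2)) := by rw [hV, Real.exp_add, Real.exp_log hn0]
      _ ≤ Real.exp (p / 2) := Real.exp_le_exp.2 (by linarith)
  let I : Finset (Finset V) :=
    {T | d ≤ T.card ∧ ∀ v ∈ T, d ≤ (T.filter (G.Adj v)).card}
  let F : Finset V → Finset (Sym2 V) := fun T => (G.edgesWithin T).edgeSet.toFinset
  have hbound : ∑ T ∈ I, (1 - p) ^ (F T).card ≤ ε := by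
    calc ∑ T ∈ I, (1 - p) ^ (F T).card
        ≤ ∑ T ∈ I, Real.exp (-(p * d / 2)) ^ T.card := by
          refine Finset.sum_le_sum fun T hT => ?_
          have hcard : (T.card : ℝ) * d ≤ 2 * (F T).card := by
            exact_mod_cast G.card_mul_le_two_mul_card_edgesWithin T d
              (Finset.mem_filter.1 hT).2.2
          calc (1 - p) ^ (F T).card ≤ Real.exp (-p) ^ (F T).card :=
                pow_le_pow_left₀ (by linarith) (Real.one_sub_le_exp_neg p) _
            _ ≤ Real.exp (-(p * d / 2)) ^ T.card := by
                rw [← Real.exp_nat_mul, ← Real.exp_nat_mul, Real.exp_le_exp]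
                nlinarith
      _ ≤ ∑ T : Finset V with d ≤ T.card, Real.exp (-(p * d / 2)) ^ T.card :=
          Finset.sum_le_sum_of_subset_of_nonneg
            (fun T hT => by simpa using (Finset.mem_filter.1 hT).2.1)
            (fun _ _ _ => by positivity)
      _ ≤ _ := sum_pow_card_le d _ _ (Real.exp_pos _).le hnq
      _ ≤ ε := (hN d hNd _).le
  refine (sub_le_sub_left hbound 1).trans
    (one_sub_sum_le_subgraphProb G p hp0.le hp1.le _ I F (fun T _ => ?_) fun s hs => ?_)
  · intro e he
    have hle : G.edgesWithin T ≤ G := fun _ _ h => h.1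
    simpa using SimpleGraph.edgeSet_mono hle (by simpa [F] using he)
  · set G' : SimpleGraph V := SimpleGraph.fromEdgeSet ↑s with hG'
    set c := G'.chromaticNumber.toNat with hc
    have hcol : G'.Colorable c := by
      have hne : G'.chromaticNumber ≠ ⊤ :=
        SimpleGraph.chromaticNumber_ne_top_iff_exists.2 ⟨_, G'.colorable_of_fintype⟩
      rw [← SimpleGraph.chromaticNumber_le_iff_colorable, hc, ENat.natCast_toNat hne]
    have hncol : ¬ G.Colorable (c * d) := by
      intro h
      have hkle : k ≤ c * d := by
        have := SimpleGraph.chromaticNumber_le_iff_colorable.2 h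
        rw [hk] at this
        exact_mod_cast this
      have hkle' : (k : ℝ) ≤ c * d := by exact_mod_cast hkle
      refine hs ((div_le_iff₀ (by positivity)).2 ?_)
      calc p * (k : ℝ) ≤ p * (c * d) := by gcongr
        _ = c * (d * p) := by ring
        _ ≤ c * (2 * Real.log n) := by gcongr
    obtain ⟨T, ⟨v, hv⟩, hdeg, hind⟩ := G.exists_indep_of_not_colorable G' c d hcol hncol
    refine ⟨T, ?_, Finset.disjoint_left.2 fun e hes heF => ?_⟩
    · simp only [I, Finset.mem_filter, Finset.mem_univ, true_and]
      exact ⟨(hdeg v hv).trans (Finset.card_filter_le _ _), hdeg⟩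
    · induction e using Sym2.ind with
      | _ x y =>
        have hxy : (G.edgesWithin T).Adj x y := by simpa [F] using heF
        exact hind x hxy.2.1 y hxy.2.2
          ((SimpleGraph.fromEdgeSet_adj _).2 ⟨by simpa using hes, hxy.1.ne⟩)
end

section
/- For every p ∈ (0,1) and every ε > 0 there exists n₀ such that for every n ≥ n₀ and every finite simple graph G on n vertices, the probability that there exists a set V' of vertices such that the induced subgraph G[V'] has minimum degree at least 2·(ln n)/p and V' is an independent set in the random subgraph G_p is at most ε. -/
open scoped Classical

/-- The subgraph of `G` (on the same vertex type) formed by the edges with both ends in `W`. -/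
def restrictTo {V : Type} (G : SimpleGraph V) (W : Finset V) : SimpleGraph V where
  Adj u v := G.Adj u v ∧ u ∈ W ∧ v ∈ W
  symm := ⟨fun _ _ h => ⟨h.1.symm, h.2.2, h.2.1⟩⟩
  loopless := ⟨fun v h => G.loopless.irrefl v h.1⟩

theorem restrictTo_le {V : Type} (G : SimpleGraph V) (W : Finset V) : restrictTo G W ≤ G :=
  fun _ _ h => h.1

/-- Union bound. -/
theorem subgraphProb_exists_le {V ι : Type} [Fintype V] (G : SimpleGraph V) {p : ℝ}
    (hp0 : 0 ≤ p) (hp1 : p ≤ 1) (T : Finset ι) {A : SimpleGraph V → Prop}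
    (B : ι → SimpleGraph V → Prop) (h : ∀ G', A G' → ∃ i ∈ T, B i G') :
    subgraphProb G p A ≤ ∑ i ∈ T, subgraphProb G p (B i) := by
  unfold subgraphProb
  rw [Finset.sum_comm]
  refine Finset.sum_le_sum fun s _ => ?_
  have hw : 0 ≤ p ^ s.card * (1 - p) ^ (G.edgeSet.toFinset.card - s.card) :=
    mul_nonneg (pow_nonneg hp0 _) (pow_nonneg (by linarith) _)
  have hnonneg : ∀ i ∈ T, 0 ≤ (if B i (SimpleGraph.fromEdgeSet ↑s) then
      p ^ s.card * (1 - p) ^ (G.edgeSet.toFinset.card - s.card) else 0) := by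
    intro i _
    split_ifs
    exacts [hw, le_rfl]
  by_cases hA : A (SimpleGraph.fromEdgeSet ↑s)
  · obtain ⟨i, hi, hB⟩ := h _ hA
    rw [if_pos hA]
    refine le_trans ?_ (Finset.single_le_sum hnonneg hi)
    rw [if_pos hB]
  · rw [if_neg hA]
    exact Finset.sum_nonneg hnonneg

/-- The probability that no edge of a subgraph `H` of `G` is retained. -/
theorem subgraphProb_forall_not_adj {V : Type} [Fintype V] {G H : SimpleGraph V} (hHG : H ≤ G)
    (p : ℝ) :
    subgraphProb G p (fun G' => ∀ u v, H.Adj u v → ¬ G'.Adj u v) =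
      (1 - p) ^ H.edgeSet.toFinset.card := by
  have hsub : H.edgeSet.toFinset ⊆ G.edgeSet.toFinset := by
    simpa using hHG
  have hcard := Finset.card_sdiff_add_card_eq_card hsub
  have hfilter : G.edgeSet.toFinset.powerset.filter (fun s : Finset (Sym2 V) =>
      ∀ u v, H.Adj u v → ¬ (SimpleGraph.fromEdgeSet (↑s : Set (Sym2 V))).Adj u v) =
      (G.edgeSet.toFinset \ H.edgeSet.toFinset).powerset := by
    ext s
    simp only [Finset.mem_filter, Finset.mem_powerset, Finset.subset_sdiff]
    refine and_congr_right fun _ => ?_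
    rw [Finset.disjoint_left]
    constructor
    · intro h e
      induction e with
      | _ u v =>
        intro hs hH
        have hH' : H.Adj u v := by simpa using hH
        exact h u v hH' (by simpa using ⟨hs, hH'.ne⟩)
    · intro h u v hH hs
      rw [SimpleGraph.fromEdgeSet_adj] at hs
      exact h (by simpa using hs.1) (by simpa using hH)
  unfold subgraphProb
  calc _ = ∑ s ∈ (G.edgeSet.toFinset \ H.edgeSet.toFinset).powerset,
        p ^ s.card * (1 - p) ^ (G.edgeSet.toFinset.card - s.card) := by
        rw [← hfilter, Finset.sum_filter]
        refine Finset.sum_congr rfl fun s _ => ?_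
        congr
    _ = ∑ s ∈ (G.edgeSet.toFinset \ H.edgeSet.toFinset).powerset,
        (p ^ s.card * (1 - p) ^ ((G.edgeSet.toFinset \ H.edgeSet.toFinset).card - s.card)) *
          (1 - p) ^ H.edgeSet.toFinset.card := by
        refine Finset.sum_congr rfl fun s hs => ?_
        have := Finset.card_le_card (Finset.mem_powerset.1 hs)
        rw [mul_assoc, ← pow_add]
        congr 2
        omega
    _ = _ := by
        rw [← Finset.sum_mul, Finset.sum_pow_mul_eq_add_pow]
        simp

/-- A lower bound on the number of edges inside `W` from a minimum degree bound. -/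
theorem card_mul_le_two_mul_card_edges {V : Type} [Fintype V] (G : SimpleGraph V) (W : Finset V)
    {d : ℝ} (hd : ∀ v ∈ W, d ≤ ((W.filter (fun u => G.Adj v u)).card : ℝ)) :
    W.card * d ≤ 2 * ((restrictTo G W).edgeSet.toFinset.card : ℝ) := by
  have hsum := (restrictTo G W).sum_degrees_eq_twice_card_edges
  have hdeg : ∀ v ∈ W, (W.filter (fun u => G.Adj v u)).card = (restrictTo G W).degree v := by
    intro v hv
    rw [← SimpleGraph.card_neighborFinset_eq_degree]
    congr 1
    ext u
    rw [SimpleGraph.mem_neighborFinset, Finset.mem_filter]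
    exact ⟨fun h => ⟨h.2, hv, h.1⟩, fun h => ⟨h.2.2, h.1⟩⟩
  calc W.card * d ≤ ∑ v ∈ W, ((W.filter (fun u => G.Adj v u)).card : ℝ) := by
        rw [← nsmul_eq_mul]
        exact Finset.card_nsmul_le_sum _ _ _ hd
    _ = ((∑ v ∈ W, (restrictTo G W).degree v : ℕ) : ℝ) := by
        push_cast
        exact Finset.sum_congr rfl fun v hv => by rw [hdeg v hv]
    _ ≤ ((∑ v, (restrictTo G W).degree v : ℕ) : ℝ) := by
        exact_mod_cast Finset.sum_le_sum_of_subset (Finset.subset_univ W)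
    _ = _ := by
        rw [hsum]
        push_cast
        rfl

/-- First-moment bound, with `x = n ^ (log (1 - p) / p)`. -/
theorem subgraphProb_exists_independent_le {V : Type} [Fintype V] (G : SimpleGraph V) {p : ℝ}
    (hp0 : 0 < p) (hp1 : p < 1) (L : ℝ) :
    subgraphProb G p
      (fun G' => ∃ W : Finset V, W.Nonempty ∧
        (∀ v ∈ W, 2 * L / p ≤ ((W.filter (fun u => G.Adj v u)).card : ℝ)) ∧
        (∀ u ∈ W, ∀ v ∈ W, ¬ G'.Adj u v)) ≤
      Real.exp (Fintype.card V * Real.exp (Real.log (1 - p) * (L / p))) - 1 := by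
  set x := Real.exp (Real.log (1 - p) * (L / p)) with hx
  have hq : 0 < 1 - p := by linarith
  set T : Finset (Finset V) := Finset.univ.filter (fun W => W.Nonempty ∧
    ∀ v ∈ W, 2 * L / p ≤ ((W.filter (fun u => G.Adj v u)).card : ℝ)) with hT
  have hpow : ∀ W ∈ T, (1 - p) ^ (restrictTo G W).edgeSet.toFinset.card ≤ x ^ W.card := by
    intro W hW
    have hedges := card_mul_le_two_mul_card_edges G W (Finset.mem_filter.1 hW).2.2
    have hlog : Real.log (1 - p) ≤ 0 := Real.log_nonpos hq.le (by linarith)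
    rw [← Real.exp_log hq, ← Real.exp_nat_mul, hx, ← Real.exp_nat_mul, Real.exp_le_exp]
    have hle : (W.card : ℝ) * (L / p) ≤ (restrictTo G W).edgeSet.toFinset.card := by
      rw [mul_div_assoc] at hedges
      linarith
    nlinarith [mul_le_mul_of_nonpos_left hle hlog]
  calc _ ≤ ∑ W ∈ T, subgraphProb G p
        (fun G' => ∀ u v, (restrictTo G W).Adj u v → ¬ G'.Adj u v) := by
        refine subgraphProb_exists_le G hp0.le hp1.le T _ ?_
        rintro G' ⟨W, hne, hdeg, hind⟩
        exact ⟨W, Finset.mem_filter.2 ⟨Finset.mem_univ _, hne, hdeg⟩,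
          fun u v h => hind u h.2.1 v h.2.2⟩
    _ = ∑ W ∈ T, (1 - p) ^ (restrictTo G W).edgeSet.toFinset.card :=
        Finset.sum_congr rfl fun W _ => subgraphProb_forall_not_adj (restrictTo_le G W) p
    _ ≤ ∑ W ∈ T, x ^ W.card := Finset.sum_le_sum hpow
    _ ≤ ∑ W ∈ Finset.univ.erase (∅ : Finset V), x ^ W.card := by
        refine Finset.sum_le_sum_of_subset_of_nonneg ?_ fun _ _ _ => by positivity
        intro W hW
        exact Finset.mem_erase.2 ⟨(Finset.mem_filter.1 hW).2.1.ne_empty, Finset.mem_univ _⟩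
    _ = (x + 1) ^ Fintype.card V - 1 := by
        rw [Finset.sum_erase_eq_sub (Finset.mem_univ _)]
        have := Finset.sum_pow_mul_eq_add_pow x 1 (Finset.univ : Finset V)
        simpa using this
    _ ≤ _ := by
        rw [Real.exp_nat_mul]
        gcongr
        exact Real.add_one_le_exp x

theorem tendsto_exp_mul_exp_log {p : ℝ} (hp0 : 0 < p) (hp1 : p < 1) :
    Filter.Tendsto (fun n : ℕ =>
      Real.exp (n * Real.exp (Real.log (1 - p) * (Real.log n / p))) - 1)
      Filter.atTop (nhds 0) := by
  have hlog : Real.log (1 - p) < -p := by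
    have := Real.log_lt_sub_one_of_pos (x := 1 - p) (by linarith) (by linarith)
    linarith
  have hc : 0 < -(1 + Real.log (1 - p) / p) := by
    have : Real.log (1 - p) / p < -1 := by
      rw [div_lt_iff₀ hp0]
      linarith
    linarith
  have hlim := (tendsto_rpow_neg_atTop hc).comp (tendsto_natCast_atTop_atTop (R := ℝ))
  have hexp := ((Real.continuous_exp.tendsto 0).comp hlim).sub_const 1
  rw [Real.exp_zero, sub_self] at hexp
  refine hexp.congr' ?_
  filter_upwards [Filter.eventually_gt_atTop 0] with n hn
  have hn' : (0 : ℝ) < n := by exact_mod_cast hn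
  simp only [Function.comp_apply]
  rw [Real.rpow_def_of_pos hn']
  congr 2
  nth_rewrite 2 [← Real.exp_log hn']
  rw [← Real.exp_add]
  congr 1
  ring

/-- For every `p ∈ (0,1)` and `ε > 0`, for all large enough `n`, for every `n`-vertex graph `G`,
with probability at least `1 - ε` there is no vertex set `V'` such that the subgraph of `G`
induced on `V'` has minimum degree at least `2 ln n / p` and `V'` is independent in `G_p`. -/
theorem no_independent_set_of_high_min_degree (p : ℝ) (hp0 : 0 < p) (hp1 : p < 1)
    (ε : ℝ) (hε : 0 < ε) :
    ∃ n₀ : ℕ, ∀ n : ℕ, n₀ ≤ n →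
      ∀ (V : Type) [Fintype V], Fintype.card V = n →
        ∀ (G : SimpleGraph V),
          subgraphProb G p
            (fun G' => ∃ V' : Finset V, V'.Nonempty ∧
              (∀ v ∈ V', 2 * Real.log n / p ≤ ((V'.filter (fun u => G.Adj v u)).card : ℝ)) ∧
              (∀ u ∈ V', ∀ v ∈ V', ¬ G'.Adj u v)) ≤ ε := by
  obtain ⟨n₀, hn₀⟩ := Filter.eventually_atTop.1
    ((tendsto_exp_mul_exp_log hp0 hp1).eventually (ge_mem_nhds hε))
  refine ⟨n₀, fun n hn V _ hV G => ?_⟩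
  have h := subgraphProb_exists_independent_le G hp0 hp1 (Real.log n)
  rw [hV] at h
  exact h.trans (hn₀ n hn)
end

section
/- There exists a universal constant c > 0 such that for all sufficiently large n there exists a directed graph H on n vertices (without loops or multiple edges) in which every vertex has in-degree exactly 2 and out-degree exactly 2, and such that for every nonempty proper subset S of the vertices, the number of vertices outside S that are out-neighbours of some vertex of S is at least c·min(|S|, n − |S|). -/
open scoped Classical

theorem le_choose_of_pos_of_lt {m s : ℕ} (hs : 0 < s) (hsm : s < m) : m ≤ m.choose s := by
  induction m generalizing s with
  | zero => omega
  | succ m ih =>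
    obtain ⟨s, rfl⟩ : ∃ k, s = k + 1 := ⟨s - 1, by omega⟩
    rw [Nat.choose_succ_succ]
    rcases Nat.eq_zero_or_pos s with rfl | h
    · simp [add_comm]
    · have h1 := ih h (by omega)
      have h2 : 0 < m.choose (s + 1) := Nat.choose_pos (by omega)
      simp only [Nat.succ_eq_add_one]
      omega

theorem div_pow_le_choose {m s : ℕ} (hsm : s ≤ m) :
    ((m : ℝ) / s) ^ s ≤ m.choose s := by
  induction s generalizing m with
  | zero => simp
  | succ s ih =>
    obtain ⟨m, rfl⟩ : ∃ k, m = k + 1 := ⟨m - 1, by omega⟩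
    have hle : s ≤ m := by omega
    have h := ih hle
    have key : ((m + 1 : ℝ) * m.choose s) = (m + 1).choose (s + 1) * (s + 1) := by
      exact_mod_cast Nat.add_one_mul_choose_eq m s
    have hdiv : ((m + 1).choose (s + 1) : ℝ) = (m + 1 : ℝ) / (s + 1) * m.choose s := by
      field_simp
      linarith
    push_cast
    rw [hdiv, _root_.pow_succ']
    gcongr
    rcases Nat.eq_zero_or_pos s with rfl | hs
    · simp
    · refine le_trans ?_ h
      have : (s : ℝ) ≤ m := by exact_mod_cast hle
      gcongr 1
      rw [div_le_div_iff₀ (by positivity) (by positivity)]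
      nlinarith

/-- The number of subsets of size at most `t` of an `m`-element type is at most `(3m/t)^t`. -/
theorem card_filter_card_le_mul_pow_le {V : Type*} [Fintype V] [DecidableEq V] {t : ℕ}
    (htm : t ≤ Fintype.card V) :
    (((Finset.univ : Finset (Finset V)).filter (fun X => X.card ≤ t)).card : ℝ) * t ^ t
      ≤ (3 * Fintype.card V) ^ t := by
  rcases Nat.eq_zero_or_pos t with rfl | ht
  · have : ((Finset.univ : Finset (Finset V)).filter (fun X => X.card ≤ 0)) = {∅} := by
      ext X
      simp
    rw [this]
    simp
  set m := Fintype.card V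
  have hm : (0 : ℝ) < m := by exact_mod_cast ht.trans_le htm
  have ht' : (0 : ℝ) < t := by exact_mod_cast ht
  set x : ℝ := t / m with hx
  have hx0 : 0 < x := by positivity
  have hx1 : x ≤ 1 := (div_le_one hm).2 (by exact_mod_cast htm)
  have hsum : ∑ X : Finset V, x ^ X.card = (1 + x) ^ m := by
    have := Finset.prod_one_add (f := fun _ : V => x) (Finset.univ : Finset V)
    simpa [m] using this.symm
  have h1 : (((Finset.univ : Finset (Finset V)).filter (fun X => X.card ≤ t)).card : ℝ) * x ^ t
      ≤ (1 + x) ^ m := by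
    rw [← hsum, ← nsmul_eq_mul, ← Finset.sum_const]
    refine le_trans (Finset.sum_le_sum (g := fun X : Finset V => x ^ X.card) ?_)
      (Finset.sum_le_sum_of_subset_of_nonneg (Finset.filter_subset _ _) ?_)
    · intro X hX
      exact pow_le_pow_of_le_one hx0.le hx1 (Finset.mem_filter.1 hX).2
    · intro X _ _
      positivity
  have h2 : (1 + x) ^ m ≤ 3 ^ t := by
    have h3 : 1 + x ≤ Real.exp x := by linarith [Real.add_one_le_exp x]
    calc (1 + x) ^ m ≤ Real.exp x ^ m := by gcongr
      _ = Real.exp 1 ^ t := by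
        rw [← Real.exp_nat_mul, ← Real.exp_nat_mul, hx]
        congr 1
        field_simp
      _ ≤ 3 ^ t := by
        gcongr
        linarith [Real.exp_one_lt_d9]
  have h3 := h1.trans h2
  rw [hx, div_pow, ← mul_div_assoc, div_le_iff₀ (by positivity)] at h3
  rwa [mul_pow]

theorem mul_pow_le_choose {m s : ℕ} (B : ℝ) (hB : 0 ≤ B) (hs : 0 < s) (hsm : 2 * s ≤ m)
    (h : B * (s / 100 : ℕ) ^ (s / 100) ≤ (3 * m) ^ (s / 100)) :
    m * (B ^ 2) ^ 2 ≤ m.choose s := by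
  set t := s / 100 with ht
  rcases Nat.eq_zero_or_pos t with h0 | htpos
  · simp only [h0, pow_zero, mul_one] at h
    calc (m : ℝ) * (B ^ 2) ^ 2 ≤ (m : ℝ) * (1 ^ 2) ^ 2 := by gcongr
      _ ≤ (m.choose s : ℝ) := by
        rw [one_pow, one_pow, mul_one]
        exact_mod_cast le_choose_of_pos_of_lt hs (by omega)
  have hs' : (0 : ℝ) < s := by exact_mod_cast hs
  have ht' : (0 : ℝ) < t := by exact_mod_cast htpos
  set y : ℝ := m / s with hy
  have hy2 : 2 ≤ y := by
    rw [hy, le_div_iff₀ hs']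
    exact_mod_cast hsm
  have hts : (s : ℝ) ≤ 200 * t := by
    have : s ≤ 200 * t := by omega
    exact_mod_cast this
  have hmy : (m : ℝ) = y * s := by rw [hy]; field_simp
  have hB1 : B ≤ (600 * y) ^ t := by
    have h1 : B * (t : ℝ) ^ t ≤ (600 * y) ^ t * t ^ t := by
      refine h.trans ?_
      rw [← mul_pow, hmy]
      gcongr ?_ ^ t
      nlinarith
    exact le_of_mul_le_mul_right h1 (by positivity)
  have hpow : (600 * y) ^ 4 ≤ y ^ 50 := by
    have : (600 : ℝ) ^ 4 ≤ y ^ 46 := le_trans (by norm_num) (pow_le_pow_left₀ (by norm_num) hy2 46)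
    calc (600 * y) ^ 4 = 600 ^ 4 * y ^ 4 := by ring
      _ ≤ y ^ 46 * y ^ 4 := by gcongr
      _ = y ^ 50 := by ring
  have hB4 : (B ^ 2) ^ 2 ≤ y ^ (50 * t) := by
    calc (B ^ 2) ^ 2 ≤ (((600 * y) ^ t) ^ 2) ^ 2 := by gcongr
      _ = ((600 * y) ^ 4) ^ t := by
        simp only [← pow_mul]
        congr 1
        omega
      _ ≤ (y ^ 50) ^ t := by gcongr
      _ = y ^ (50 * t) := by rw [pow_mul]
  obtain ⟨u, hu⟩ : ∃ u, s = 50 * t + (u + 2) := ⟨s - 50 * t - 2, by omega⟩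
  have hu48 : 48 ≤ u := by omega
  have h2u : ∀ k : ℕ, 48 ≤ k → (2 * (k + 2)) ^ 2 ≤ 2 ^ k := by
    intro k hk
    induction k, hk using Nat.le_induction with
    | base => norm_num
    | succ k hk ih => rw [pow_succ 2 k]; nlinarith
  have hsu : (s : ℝ) ^ 2 ≤ 2 ^ u := by
    have h1 : s ≤ 2 * (u + 2) := by omega
    exact_mod_cast (Nat.pow_le_pow_left h1 2).trans (h2u u hu48)
  have hm1 : (1 : ℝ) ≤ m := by
    have : 1 ≤ m := by omega
    exact_mod_cast this
  have hmle : (m : ℝ) ≤ y ^ (u + 2) := by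
    calc (m : ℝ) ≤ m ^ 2 := by nlinarith
      _ = s ^ 2 * y ^ 2 := by rw [hmy]; ring
      _ ≤ 2 ^ u * y ^ 2 := by gcongr
      _ ≤ y ^ u * y ^ 2 := by gcongr
      _ = y ^ (u + 2) := by ring
  calc (m : ℝ) * (B ^ 2) ^ 2 ≤ y ^ (u + 2) * y ^ (50 * t) := by gcongr
    _ = y ^ s := by rw [← pow_add, add_comm (u + 2), ← hu]
    _ ≤ m.choose s := div_pow_le_choose (by omega)

section Escape

variable {V : Type*} [DecidableEq V]

/-- The number of elements of `S` that the permutation `f` moves out of `S`. -/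
def escape (f : Equiv.Perm V) (S : Finset V) : ℕ := (S.filter (fun x => f x ∉ S)).card

theorem escape_eq_card_image_sdiff (f : Equiv.Perm V) (S : Finset V) :
    escape f S = (S.image f \ S).card := by
  rw [escape, ← Finset.card_image_of_injective _ f.injective]
  congr 1
  ext y
  simp only [Finset.mem_image, Finset.mem_filter, Finset.mem_sdiff]
  constructor
  · rintro ⟨x, ⟨hx, hfx⟩, rfl⟩
    exact ⟨⟨x, hx, rfl⟩, hfx⟩
  · rintro ⟨⟨x, hx, rfl⟩, hfx⟩
    exact ⟨x, ⟨hx, hfx⟩, rfl⟩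

variable [Fintype V]

theorem escape_compl (f : Equiv.Perm V) (S : Finset V) : escape f Sᶜ = escape f S := by
  have h1 : (S.image f \ S).card = (S \ S.image f).card :=
    Finset.card_sdiff_comm (Finset.card_image_of_injective _ f.injective)
  have h2 : Sᶜ.image f \ Sᶜ = S \ S.image f := by
    ext x
    obtain ⟨y, rfl⟩ := f.surjective x
    simp [and_comm]
  rw [escape_eq_card_image_sdiff, escape_eq_card_image_sdiff, h2, h1]

theorem exists_perm_image_eq {S T : Finset V} (h : S.card = T.card) :
    ∃ f : Equiv.Perm V, S.image f = T := by
  let e : {x // x ∈ S} ≃ {x // x ∈ T} := Finset.equivOfCardEq h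
  refine ⟨e.extendSubtype, Finset.eq_of_subset_of_card_le ?_ ?_⟩
  · intro y hy
    obtain ⟨x, hx, rfl⟩ := Finset.mem_image.1 hy
    exact e.extendSubtype_mem x hx
  · rw [Finset.card_image_of_injective _ (Equiv.injective _), h]

theorem card_perm_image_eq_mul_choose {S T : Finset V} (h : S.card = T.card) :
    ((Finset.univ : Finset (Equiv.Perm V)).filter (fun f : Equiv.Perm V => S.image f = T)).card
      * (Fintype.card V).choose S.card = (Fintype.card V).factorial := by
  have hconst : ∀ T' ∈ Finset.powersetCard S.card (Finset.univ : Finset V),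
      ((Finset.univ : Finset (Equiv.Perm V)).filter (fun f : Equiv.Perm V => S.image f = T')).card
        = ((Finset.univ : Finset (Equiv.Perm V)).filter (fun f : Equiv.Perm V => S.image f = T)).card := by
    intro T' hT'
    obtain ⟨g, hg⟩ := exists_perm_image_eq
      (h.symm.trans (Finset.mem_powersetCard.1 hT').2.symm)
    symm
    refine Finset.card_equiv (Equiv.mulLeft g) ?_
    intro f
    simp only [Finset.mem_filter, Finset.mem_univ, true_and, Equiv.coe_mulLeft,
      Equiv.Perm.coe_mul, ← Finset.image_image, ← hg]
    exact (Finset.image_injective g.injective).eq_iff.symm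
  have hsum := Finset.card_eq_sum_card_fiberwise (f := fun f : Equiv.Perm V => S.image f)
    (s := Finset.univ) (t := Finset.powersetCard S.card (Finset.univ : Finset V)) (by
      intro f _
      simp [Finset.mem_powersetCard, Finset.card_image_of_injective _ f.injective])
  rw [Finset.sum_congr rfl hconst, Finset.sum_const, Finset.card_powersetCard, Finset.card_univ,
    Finset.card_univ, Fintype.card_perm, smul_eq_mul] at hsum
  rw [hsum, mul_comm]

theorem card_filter_card_sdiff_le (S : Finset V) (t : ℕ) :
    ((Finset.univ : Finset (Finset V)).filter
      (fun T => S.card = T.card ∧ (T \ S).card ≤ t)).card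
      ≤ ((Finset.univ : Finset (Finset V)).filter (fun X => X.card ≤ t)).card ^ 2 := by
  rw [sq, ← Finset.card_product]
  refine Finset.card_le_card_of_injOn (fun T => (T \ S, S \ T)) ?_ ?_
  · intro T hT
    obtain ⟨h1, h2⟩ : S.card = T.card ∧ (T \ S).card ≤ t := by simpa using hT
    have h3 := Finset.card_sdiff_comm h1
    simp only [Finset.coe_product, Set.mem_prod, Finset.mem_coe, Finset.mem_filter,
      Finset.mem_univ, true_and]
    exact ⟨h2, h3.trans_le h2⟩
  · intro T _ T' _ h
    obtain ⟨h1, h2⟩ := Prod.mk.inj h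
    ext x
    have h3 := Finset.ext_iff.1 h1 x
    have h4 := Finset.ext_iff.1 h2 x
    simp only [Finset.mem_sdiff] at h3 h4
    tauto

theorem card_escape_le_mul_choose_le (S : Finset V) (t : ℕ) :
    ((Finset.univ : Finset (Equiv.Perm V)).filter (fun f => escape f S ≤ t)).card
        * (Fintype.card V).choose S.card
      ≤ ((Finset.univ : Finset (Finset V)).filter (fun X => X.card ≤ t)).card ^ 2
        * (Fintype.card V).factorial := by
  set 𝒯 := (Finset.univ : Finset (Finset V)).filter
      (fun T => S.card = T.card ∧ (T \ S).card ≤ t)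
  have hsub : (Finset.univ : Finset (Equiv.Perm V)).filter (fun f => escape f S ≤ t)
      ⊆ 𝒯.biUnion fun T => Finset.univ.filter (fun f : Equiv.Perm V => S.image f = T) := by
    intro f hf
    have hf' : escape f S ≤ t := (Finset.mem_filter.1 hf).2
    rw [escape_eq_card_image_sdiff] at hf'
    simp [𝒯, hf', Finset.card_image_of_injective _ f.injective]
  calc _ ≤ (∑ T ∈ 𝒯, (Finset.univ.filter (fun f : Equiv.Perm V => S.image f = T)).card)
        * (Fintype.card V).choose S.card :=
        Nat.mul_le_mul_right _ ((Finset.card_le_card hsub).trans Finset.card_biUnion_le)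
    _ = 𝒯.card * (Fintype.card V).factorial := by
        rw [Finset.sum_mul, ← smul_eq_mul 𝒯.card, ← Finset.sum_const]
        refine Finset.sum_congr rfl fun T hT => ?_
        exact card_perm_image_eq_mul_choose (Finset.mem_filter.1 hT).2.1
    _ ≤ _ := Nat.mul_le_mul_right _ (card_filter_card_sdiff_le S t)

theorem card_escape_le_sq_le {S : Finset V} (hS : 0 < S.card)
    (hSV : 2 * S.card ≤ Fintype.card V) :
    (((Finset.univ : Finset (Equiv.Perm V)).filter
        (fun f => escape f S ≤ S.card / 100)).card : ℝ) ^ 2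
      ≤ ((Fintype.card V).factorial : ℝ) ^ 2 / Fintype.card V
        / (Fintype.card V).choose S.card := by
  set m := Fintype.card V
  set t := S.card / 100
  set B := ((Finset.univ : Finset (Finset V)).filter (fun X => X.card ≤ t)).card
  set P := ((Finset.univ : Finset (Equiv.Perm V)).filter (fun f => escape f S ≤ t)).card
  have hC : (0 : ℝ) < m.choose S.card := by
    exact_mod_cast Nat.choose_pos (by omega)
  have hm : (0 : ℝ) < m := by
    have : 0 < m := by omega
    exact_mod_cast this
  have hB : (m : ℝ) * ((B : ℝ) ^ 2) ^ 2 ≤ m.choose S.card :=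
    mul_pow_le_choose B (by positivity) hS hSV
      (card_filter_card_le_mul_pow_le (V := V) (t := t) (by omega))
  have hP : (P : ℝ) * m.choose S.card ≤ (B : ℝ) ^ 2 * m.factorial := by
    exact_mod_cast card_escape_le_mul_choose_le S t
  rw [div_div, le_div_iff₀ (by positivity)]
  refine le_of_mul_le_mul_right ?_ hC
  calc (P : ℝ) ^ 2 * (m * m.choose S.card) * m.choose S.card
      = m * (P * m.choose S.card) ^ 2 := by ring
    _ ≤ m * ((B : ℝ) ^ 2 * m.factorial) ^ 2 := by gcongr
    _ = m * ((B : ℝ) ^ 2) ^ 2 * (m.factorial : ℝ) ^ 2 := by ring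
    _ ≤ m.choose S.card * (m.factorial : ℝ) ^ 2 := by gcongr
    _ = (m.factorial : ℝ) ^ 2 * m.choose S.card := mul_comm _ _

variable (V) in
theorem exists_perm_pair_escape_gt :
    ∃ f g : Equiv.Perm V, ∀ S : Finset V, 0 < S.card → 2 * S.card ≤ Fintype.card V →
      S.card / 100 < escape f S ∨ S.card / 100 < escape g S := by
  by_contra! hcon
  set m := Fintype.card V with hmdef
  set 𝒮 := (Finset.univ : Finset (Finset V)).filter (fun S => 0 < S.card ∧ 2 * S.card ≤ m)
  let bad : Finset V → Finset (Equiv.Perm V) := fun S =>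
    Finset.univ.filter (fun f => escape f S ≤ S.card / 100)
  have hcover : (Finset.univ : Finset (Equiv.Perm V × Equiv.Perm V))
      ⊆ 𝒮.biUnion fun S => bad S ×ˢ bad S := by
    rintro ⟨f, g⟩ -
    obtain ⟨S, h1, h2, h3, h4⟩ := hcon f g
    exact Finset.mem_biUnion.2 ⟨S, by simp only [𝒮, Finset.mem_filter, Finset.mem_univ]; tauto,
      by simp [bad, h3, h4]⟩
  have hm : 0 < m := by
    obtain ⟨S, h1, h2, -⟩ := hcon 1 1
    omega
  have hm' : (0 : ℝ) < m := by exact_mod_cast hm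
  have hcard : (m.factorial : ℝ) ^ 2 ≤ ∑ S ∈ 𝒮, ((bad S).card : ℝ) ^ 2 := by
    have h := (Finset.card_le_card hcover).trans Finset.card_biUnion_le
    simp only [Finset.card_univ, Fintype.card_prod, Fintype.card_perm, Finset.card_product,
      ← sq] at h
    exact_mod_cast h
  have hmaps : ∀ S ∈ 𝒮, S.card ∈ Finset.Icc 1 (m / 2) := by
    intro S hS
    have := (Finset.mem_filter.1 hS).2
    rw [Finset.mem_Icc]
    omega
  have hbound : ∑ S ∈ 𝒮, ((bad S).card : ℝ) ^ 2
      ≤ ∑ s ∈ Finset.Icc 1 (m / 2), (m.factorial : ℝ) ^ 2 / m := by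
    rw [← Finset.sum_fiberwise_of_maps_to hmaps]
    refine Finset.sum_le_sum fun s hs => ?_
    have hs' := Finset.mem_Icc.1 hs
    have hC : (0 : ℝ) < m.choose s := by
      exact_mod_cast Nat.choose_pos (by omega)
    calc ∑ S ∈ 𝒮.filter (fun S => S.card = s), ((bad S).card : ℝ) ^ 2
        ≤ ∑ S ∈ 𝒮.filter (fun S => S.card = s), (m.factorial : ℝ) ^ 2 / m / m.choose s := by
          refine Finset.sum_le_sum fun S hS => ?_
          obtain ⟨h1, rfl⟩ := Finset.mem_filter.1 hS
          have h2 := (Finset.mem_filter.1 h1).2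
          exact card_escape_le_sq_le h2.1 h2.2
      _ ≤ ∑ S ∈ Finset.powersetCard s (Finset.univ : Finset V),
            (m.factorial : ℝ) ^ 2 / m / m.choose s := by
          refine Finset.sum_le_sum_of_subset_of_nonneg ?_ fun _ _ _ => by positivity
          intro S hS
          simp [Finset.mem_powersetCard, (Finset.mem_filter.1 hS).2]
      _ = (m.factorial : ℝ) ^ 2 / m := by
          rw [Finset.sum_const, Finset.card_powersetCard, Finset.card_univ, nsmul_eq_mul,
            ← hmdef]
          field_simp
  have hfin := hcard.trans hbound
  rw [Finset.sum_const, Nat.card_Icc, Nat.add_sub_cancel, nsmul_eq_mul] at hfin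
  have hhalf : ((m / 2 : ℕ) : ℝ) ≤ m / 2 := Nat.cast_div_le
  have hfac : (0 : ℝ) < (m.factorial : ℝ) ^ 2 := by positivity
  have : ((m / 2 : ℕ) : ℝ) * ((m.factorial : ℝ) ^ 2 / m) ≤ (m.factorial : ℝ) ^ 2 / 2 := by
    calc _ ≤ ((m : ℝ) / 2) * ((m.factorial : ℝ) ^ 2 / m) := by gcongr
      _ = _ := by field_simp
  linarith

/-- Every vertex set `S` satisfies `min |S| (|V| - |S|) ≤ K (escape f S + escape g S)`. -/
def PairExpands (K : ℕ) (f g : Equiv.Perm V) : Prop :=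
  ∀ S : Finset V, min S.card (Fintype.card V - S.card) ≤ K * (escape f S + escape g S)

variable (V) in
theorem exists_pairExpands : ∃ f g : Equiv.Perm V, PairExpands 100 f g := by
  obtain ⟨f, g, h⟩ := exists_perm_pair_escape_gt V
  have key : ∀ S : Finset V, 2 * S.card ≤ Fintype.card V →
      S.card ≤ 100 * (escape f S + escape g S) := by
    intro S hS
    rcases Nat.eq_zero_or_pos S.card with h0 | h0
    · omega
    · have := h S h0 hS
      omega
  refine ⟨f, g, fun S => ?_⟩
  have hle := Finset.card_le_univ S
  have hc := Finset.card_compl S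
  rcases le_total (2 * S.card) (Fintype.card V) with h2 | h2
  · exact (min_le_left _ _).trans (key S h2)
  · have h3 := key Sᶜ (by omega)
    rw [escape_compl, escape_compl, hc] at h3
    exact (min_le_right _ _).trans h3

omit [Fintype V] in
theorem apply_mem_of_escape_eq_zero {f : Equiv.Perm V} {S : Finset V} (h : escape f S = 0)
    {x : V} (hx : x ∈ S) : f x ∈ S := by
  by_contra hfx
  have h' := Finset.card_eq_zero.1 h
  have : x ∈ S.filter (fun x => f x ∉ S) := Finset.mem_filter.2 ⟨hx, hfx⟩
  rw [h'] at this
  exact Finset.notMem_empty _ this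

/-- The digraph with edges `x → f x` and `x → g x` has no loops and no multiple edges. -/
def IsSimplePair {V : Type*} (f g : Equiv.Perm V) : Prop :=
  ∀ x, f x ≠ x ∧ g x ≠ x ∧ f x ≠ g x

/-- Subdivide the edge `a → f a` of the functional digraph of `f` by the new point `none`. -/
def subdivide (f : Equiv.Perm V) (a : V) : Equiv.Perm (Option V) :=
  (Equiv.swap none (some a)).trans (Equiv.optionCongr f)

omit [Fintype V] in
@[simp] theorem subdivide_none (f : Equiv.Perm V) (a : V) :
    subdivide f a none = some (f a) := by
  simp [subdivide]

omit [Fintype V] in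
@[simp] theorem subdivide_some_self (f : Equiv.Perm V) (a : V) :
    subdivide f a (some a) = none := by
  simp [subdivide]

omit [Fintype V] in
theorem subdivide_some_of_ne (f : Equiv.Perm V) {a x : V} (h : x ≠ a) :
    subdivide f a (some x) = some (f x) := by
  rw [subdivide, Equiv.trans_apply,
    Equiv.swap_apply_of_ne_of_ne (by simp) (by simpa using h)]
  simp

omit [Fintype V] in
theorem IsSimplePair.subdivide {f g : Equiv.Perm V} (h : IsSimplePair f g) {a c : V}
    (hac : a ≠ c) (hfg : f a ≠ g c) : IsSimplePair (subdivide f a) (subdivide g c) := by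
  rintro (_ | x)
  · simp [hfg]
  · obtain ⟨h1, h2, h3⟩ := h x
    by_cases hxa : x = a
    · subst hxa
      simp [subdivide_some_of_ne g hac, h2]
    · by_cases hxc : x = c
      · subst hxc
        simp [subdivide_some_of_ne f hxa, h1]
      · simp [subdivide_some_of_ne f hxa, subdivide_some_of_ne g hxc, h1, h2, h3]

omit [Fintype V] in
theorem escape_eraseNone_le (f : Equiv.Perm V) (a : V) (S : Finset (Option V)) :
    escape f (Finset.eraseNone S) ≤ escape (subdivide f a) S := by
  refine Finset.card_le_card_of_injOn (fun x => if x = a ∧ none ∈ S then none else some x) ?_ ?_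
  · intro x hx
    obtain ⟨h1, h2⟩ : some x ∈ S ∧ some (f x) ∉ S := by simpa using hx
    simp only [Finset.mem_coe, Finset.mem_filter]
    by_cases hxa : x = a
    · subst hxa
      by_cases hn : none ∈ S <;> simp [hn, h1, h2]
    · simp [hxa, subdivide_some_of_ne f hxa, h1, h2]
  · intro x _ y _ hxy
    by_cases hn : none ∈ S <;> by_cases hx : x = a <;> by_cases hy : y = a <;> simp_all

theorem PairExpands.subdivide {K : ℕ} {f g : Equiv.Perm V} (h : PairExpands K f g) (a c : V) :
    PairExpands (K + 1) (subdivide f a) (subdivide g c) := by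
  intro S
  have hS := h (Finset.eraseNone S)
  have hf := escape_eraseNone_le f a S
  have hg := escape_eraseNone_le g c S
  have hle : (Finset.eraseNone S).card ≤ Fintype.card V := Finset.card_le_univ _
  have hcard : (Finset.eraseNone S).card + (if none ∈ S then 1 else 0) = S.card := by
    split_ifs with hn
    · rw [Finset.card_eraseNone_of_mem hn]
      have := Finset.card_pos.2 ⟨_, hn⟩
      omega
    · rw [Finset.card_eraseNone_of_not_mem hn, add_zero]
  rw [Fintype.card_option]
  rcases Nat.eq_zero_or_pos (escape (_root_.subdivide f a) S + escape (_root_.subdivide g c) S)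
    with h0 | hpos
  · have hf0 : escape (_root_.subdivide f a) S = 0 := by omega
    have hb : escape f (Finset.eraseNone S) + escape g (Finset.eraseNone S) = 0 := by omega
    rw [hb, mul_zero] at hS
    by_cases hn : none ∈ S
    · have h1 := apply_mem_of_escape_eq_zero hf0 hn
      rw [subdivide_none, ← Finset.mem_eraseNone] at h1
      have h2 := Finset.card_pos.2 ⟨_, h1⟩
      simp only [hn, if_true] at hcard
      omega
    · have h1 : some a ∉ S := fun h1 => hn (by
        simpa using apply_mem_of_escape_eq_zero hf0 h1)
      have h2 : (Finset.eraseNone S).card < Fintype.card V :=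
        Finset.card_lt_univ_of_notMem (x := a) (by simpa using h1)
      simp only [hn, if_false] at hcard
      omega
  · have hK : K * (escape f (Finset.eraseNone S) + escape g (Finset.eraseNone S))
        ≤ K * (escape (_root_.subdivide f a) S + escape (_root_.subdivide g c) S) :=
      Nat.mul_le_mul_left _ (by omega)
    rw [add_mul, one_mul]
    split_ifs at hcard <;> omega

/-- The shift by one of the layers of `ZMod 3 × V`. -/
def layerShift (V : Type*) : Equiv.Perm (ZMod 3 × V) :=
  Equiv.prodShear (Equiv.addRight 1) fun _ => Equiv.refl V

/-- The shift by two of the layers of `ZMod 3 × V`, twisted by `f` on layer `0` and by `g` on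
layer `1`. -/
def twistedLayerShift {V : Type*} (f g : Equiv.Perm V) : Equiv.Perm (ZMod 3 × V) :=
  Equiv.prodShear (Equiv.addRight 2) fun i => if i = 0 then f else if i = 1 then g else 1

theorem isSimplePair_layerShift {V : Type*} (f g : Equiv.Perm V) :
    IsSimplePair (layerShift V) (twistedLayerShift f g) := by
  rintro ⟨i, x⟩
  have h : ∀ i : ZMod 3, i + 1 ≠ i ∧ i + 2 ≠ i ∧ i + 1 ≠ i + 2 := by decide
  obtain ⟨h1, h2, h3⟩ := h i
  refine ⟨fun e => h1 (congrArg Prod.fst e), fun e => h2 (congrArg Prod.fst e),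
    fun e => h3 (congrArg Prod.fst e)⟩

theorem PairExpands.layerShift {K : ℕ} {f g : Equiv.Perm V} (h : PairExpands K f g) :
    PairExpands (6 * K + 2) (layerShift V) (twistedLayerShift f g) := by
  intro S
  let L : ZMod 3 → Finset V := fun i => Finset.univ.filter fun x => (i, x) ∈ S
  have hL : ∀ i x, x ∈ L i ↔ (i, x) ∈ S := by simp [L]
  have hcard : S.card = (L 0).card + (L 1).card + (L 2).card := by
    rw [Finset.card_eq_sum_card_fiberwise (f := Prod.fst) (t := Finset.univ) (by simp)]
    have hi : ∀ i : ZMod 3, (S.filter fun p => p.1 = i).card = (L i).card := by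
      intro i
      symm
      refine Finset.card_bij (fun x _ => (i, x)) ?_ ?_ ?_
      · intro x hx
        simpa [hL] using hx
      · intro x _ y _ hxy
        simpa using hxy
      · rintro ⟨j, x⟩ hp
        obtain ⟨hp', rfl⟩ := Finset.mem_filter.1 hp
        exact ⟨x, (hL _ _).2 hp', rfl⟩
    rw [Finset.sum_congr rfl fun i _ => hi i]
    exact Fin.sum_univ_three fun i => (L i).card
  have hshift : (L 0 \ L 1).card + (L 1 \ L 2).card + (L 2 \ L 0).card
      ≤ escape (_root_.layerShift V) S := by
    have h3 : ∑ i : ZMod 3, (L i \ L (i + 1)).card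
        = (L 0 \ L 1).card + (L 1 \ L 2).card + (L 2 \ L 0).card :=
      Fin.sum_univ_three fun i : ZMod 3 => (L i \ L (i + 1)).card
    rw [← h3, ← Finset.card_sigma]
    refine Finset.card_le_card_of_injOn (fun p => (p.1, p.2)) ?_ ?_
    · rintro ⟨i, x⟩ hp
      have hp' : (i, x) ∈ S ∧ (i + 1, x) ∉ S := by simpa [hL] using hp
      simpa [_root_.layerShift] using hp'
    · rintro ⟨i, x⟩ _ ⟨j, y⟩ _ hxy
      simpa using hxy
  have htwist : ∀ i j : ZMod 3, ∀ e : Equiv.Perm V,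
      (∀ x, twistedLayerShift f g (i, x) = (j, e x)) →
      ((L i).filter fun x => e x ∉ L j).card ≤ escape (twistedLayerShift f g) S := by
    intro i j e he
    refine Finset.card_le_card_of_injOn (fun x => (i, x)) ?_ ?_
    · intro x hx
      simpa [hL, he] using hx
    · intro x _ y _ hxy
      simpa using hxy
  have hf := htwist 0 2 f (fun x => by simp [twistedLayerShift])
  have hg := htwist 1 0 g (fun x => by
    have : (1 + 2 : ZMod 3) = 0 := by decide
    simp [twistedLayerShift, this])
  have hf0 : escape f (L 0)
      ≤ ((L 0).filter fun x => f x ∉ L 2).card + (L 2 \ L 0).card := by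
    rw [← Finset.card_image_of_injective (L 2 \ L 0) f.symm.injective]
    refine (Finset.card_le_card ?_).trans (Finset.card_union_le _ _)
    intro x hx
    simp only [Finset.mem_filter, Finset.mem_union, Finset.mem_image, Finset.mem_sdiff] at hx ⊢
    by_cases h2 : f x ∈ L 2
    · exact Or.inr ⟨f x, ⟨h2, hx.2⟩, by simp⟩
    · exact Or.inl ⟨hx.1, h2⟩
  have hg0 : escape g (L 0)
      ≤ ((L 1).filter fun x => g x ∉ L 0).card + (L 0 \ L 1).card := by
    refine (Finset.card_le_card ?_).trans (Finset.card_union_le _ _)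
    intro x hx
    simp only [Finset.mem_filter, Finset.mem_union, Finset.mem_sdiff] at hx ⊢
    tauto
  have hsub : ∀ A B : Finset V, A.card ≤ B.card + (A \ B).card := fun A B => by
    have := Finset.le_card_sdiff B A
    omega
  have h01 := hsub (L 0) (L 1)
  have h12 := hsub (L 1) (L 2)
  have h20 := hsub (L 2) (L 0)
  have hm := h (L 0)
  set b := escape (_root_.layerShift V) S + escape (twistedLayerShift f g) S with hb
  have hK : K * (escape f (L 0) + escape g (L 0)) ≤ K * (2 * b) :=
    Nat.mul_le_mul_left _ (by omega)
  have hKb : (6 * K + 2) * b = 3 * (K * (2 * b)) + 2 * b := by ring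
  have h10 : (L 1).card ≤ (L 0).card + b := by omega
  have h20' : (L 2).card ≤ (L 0).card + b := by omega
  have h02 : (L 0).card ≤ (L 2).card + b := by omega
  rw [hKb, Fintype.card_prod, ZMod.card]
  omega

theorem PairExpands.mono {K K' : ℕ} (hK : K ≤ K') {f g : Equiv.Perm V}
    (h : PairExpands K f g) : PairExpands K' f g :=
  fun S => (h S).trans (Nat.mul_le_mul_right _ hK)

section Transport

variable {W : Type*} [Fintype W] [DecidableEq W]

omit [Fintype V] [Fintype W] in
theorem escape_permCongr (e : V ≃ W) (f : Equiv.Perm V) (S : Finset W) :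
    escape (e.permCongr f) S = escape f (S.map e.symm.toEmbedding) := by
  refine Finset.card_equiv e.symm fun x => ?_
  rw [Finset.mem_filter, Finset.mem_filter]
  simp

theorem PairExpands.permCongr {K : ℕ} {f g : Equiv.Perm V} (h : PairExpands K f g) (e : V ≃ W) :
    PairExpands K (e.permCongr f) (e.permCongr g) := by
  intro S
  have hS := h (S.map e.symm.toEmbedding)
  rwa [Finset.card_map, Fintype.card_congr e, ← escape_permCongr, ← escape_permCongr] at hS

omit [Fintype V] [DecidableEq V] [Fintype W] [DecidableEq W] in
theorem IsSimplePair.permCongr {f g : Equiv.Perm V} (h : IsSimplePair f g) (e : V ≃ W) :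
    IsSimplePair (e.permCongr f) (e.permCongr g) := by
  intro x
  obtain ⟨h1, h2, h3⟩ := h (e.symm x)
  refine ⟨fun h => h1 ?_, fun h => h2 ?_, fun h => h3 ?_⟩
  · simpa [Equiv.eq_symm_apply] using h
  · simpa [Equiv.eq_symm_apply] using h
  · simpa using h

end Transport

/-- There is an expanding simple pair of permutations of `Fin n`, with constant `K`. -/
def HasExpandingPair (K n : ℕ) : Prop :=
  ∃ f g : Equiv.Perm (Fin n), IsSimplePair f g ∧ PairExpands K f g

theorem HasExpandingPair.of_perm {K : ℕ} {f g : Equiv.Perm V} (hs : IsSimplePair f g)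
    (he : PairExpands K f g) : HasExpandingPair K (Fintype.card V) :=
  ⟨_, _, hs.permCongr (Fintype.equivFin V), he.permCongr (Fintype.equivFin V)⟩

theorem HasExpandingPair.succ {K n : ℕ} (hn : 3 ≤ n) (h : HasExpandingPair K n) :
    HasExpandingPair (K + 1) (n + 1) := by
  obtain ⟨f, g, hs, he⟩ := h
  let a : Fin n := ⟨0, by omega⟩
  obtain ⟨c, hc⟩ : ∃ c, c ∉ ({a, g.symm (f a)} : Finset (Fin n)) := by
    by_contra! hcon
    have h1 := Finset.card_le_card (fun x _ => hcon x : (Finset.univ : Finset (Fin n)) ⊆ _)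
    have h2 := h1.trans Finset.card_le_two
    rw [Finset.card_univ, Fintype.card_fin] at h2
    omega
  rw [Finset.mem_insert, Finset.mem_singleton, not_or] at hc
  have := HasExpandingPair.of_perm
    (hs.subdivide (a := a) (c := c) (Ne.symm hc.1) fun h => hc.2 (by simp [h]))
    (he.subdivide a c)
  simpa using this

theorem hasExpandingPair_three_mul (m : ℕ) : HasExpandingPair 602 (3 * m) := by
  obtain ⟨f, g, h⟩ := exists_pairExpands (Fin m)
  simpa [ZMod.card] using HasExpandingPair.of_perm (isSimplePair_layerShift f g) h.layerShift

theorem hasExpandingPair {n : ℕ} (hn : 3 ≤ n) : HasExpandingPair 604 n := by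
  have h0 := hasExpandingPair_three_mul (n / 3)
  have hmono : ∀ {K k : ℕ}, K ≤ 604 → HasExpandingPair K k → HasExpandingPair 604 k := by
    rintro K k hK ⟨f, g, hs, he⟩
    exact ⟨f, g, hs, he.mono hK⟩
  have h1 := h0.succ (by omega)
  have h2 := h1.succ (by omega)
  obtain h | h | h : n = 3 * (n / 3) ∨ n = 3 * (n / 3) + 1 ∨ n = 3 * (n / 3) + 1 + 1 := by omega
  · rw [h]; exact hmono (by norm_num) h0
  · rw [h]; exact hmono (by norm_num) h1
  · rw [h]; exact hmono (by norm_num) h2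

end Escape

/-- There is a universal `c > 0` such that for all sufficiently large `n` there is a directed
graph on `n` vertices (a loopless relation `A`, with `A u v` meaning an edge from `u` to `v`)
in which every vertex has in-degree `2` and out-degree `2`, and every nonempty proper vertex
subset `S` has vertex boundary (out-neighbours of `S` lying outside `S`) of size at least
`c · min(|S|, n - |S|)`. -/
theorem exists_two_regular_directed_expander :
    ∃ c : ℝ, 0 < c ∧ ∃ N : ℕ, ∀ n : ℕ, N ≤ n →
      ∃ A : Fin n → Fin n → Prop, Irreflexive A ∧
        (∀ v : Fin n, (Finset.univ.filter (fun u => A u v)).card = 2 ∧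
          (Finset.univ.filter (fun u => A v u)).card = 2) ∧
        ∀ S : Finset (Fin n), S.Nonempty → S ≠ Finset.univ →
          c * min (S.card : ℝ) ((n : ℝ) - S.card) ≤
            ((Finset.univ.filter (fun w => w ∉ S ∧ ∃ u ∈ S, A u w)).card : ℝ) := by
  refine ⟨1 / 1208, by norm_num, 3, fun n hn => ?_⟩
  obtain ⟨f, g, hs, he⟩ := hasExpandingPair hn
  refine ⟨fun u v => v = f u ∨ v = g u, ?_, fun v => ⟨?_, ?_⟩, fun S _ _ => ?_⟩
  · rintro x (h | h)
    · exact (hs x).1 h.symm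
    · exact (hs x).2.1 h.symm
  · rw [Finset.card_eq_two]
    refine ⟨f.symm v, g.symm v, fun h => (hs (f.symm v)).2.2 ?_, ?_⟩
    · rw [f.apply_symm_apply, h, g.apply_symm_apply]
    · ext u
      simp [Equiv.eq_symm_apply, eq_comm]
  · rw [Finset.card_eq_two]
    refine ⟨f v, g v, (hs v).2.2, ?_⟩
    ext u
    simp
  · set D := Finset.univ.filter (fun w => w ∉ S ∧ ∃ u ∈ S, w = f u ∨ w = g u) with hD
    have hf : escape f S ≤ D.card := by
      refine Finset.card_le_card_of_injOn f ?_ f.injective.injOn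
      intro x hx
      obtain ⟨h1, h2⟩ : x ∈ S ∧ f x ∉ S := by simpa using hx
      simpa [hD, h2] using ⟨x, h1, Or.inl rfl⟩
    have hg : escape g S ≤ D.card := by
      refine Finset.card_le_card_of_injOn g ?_ g.injective.injOn
      intro x hx
      obtain ⟨h1, h2⟩ : x ∈ S ∧ g x ∉ S := by simpa using hx
      simpa [hD, h2] using ⟨x, h1, Or.inr rfl⟩
    have hle : S.card ≤ n := by simpa using Finset.card_le_univ S
    have h1 := he S
    rw [Fintype.card_fin] at h1
    have h2 : min S.card (n - S.card) ≤ 1208 * D.card := by omega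
    have h3 : min (S.card : ℝ) ((n : ℝ) - S.card) ≤ 1208 * D.card := by
      rw [← Nat.cast_sub hle]
      exact_mod_cast h2
    have h4 : 1 / 1208 * min (S.card : ℝ) ((n : ℝ) - S.card) ≤ D.card := by linarith
    convert h4
end
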